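/- There is a constant c > 0 such that the following holds for all n and all Δ with log n ≤ Δ ≤ c·n^{1/3}. Every graph G on n vertices satisfying (i) |N_G(X)| ≥ 7Δ·n^{2/3}·|X| for every set X ⊆ V(G) with 1 ≤ |X| < n^{1/3}/(14Δ), and (ii) e_G(X,Y) > 0 for all disjoint sets X, Y ⊆ V(G) with |X| = |Y| = ⌈n^{1/3}/(14Δ)⌉, is universal for 𝓣(n,Δ), i.e. G contains a copy of every tree on n vertices with maximum degree at most Δ. -/

import Mathlib

open MeasureTheory Filter Topology

/-- Bernoulli measure on `Bool` with success probability `p` (clamped to `[0,1]`). -/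
noncomputable def bernoulliMeasure (p : ℝ) : Measure Bool :=
  (min (ENNReal.ofReal p) 1) • Measure.dirac true +
    (1 - min (ENNReal.ofReal p) 1) • Measure.dirac false

/-- The distribution of the binomial random graph `G(n,p)`, as a product of independent
Bernoulli measures, one for each potential edge. -/
noncomputable def gnp (n : ℕ) (p : ℝ) : Measure (Sym2 (Fin n) → Bool) :=
  Measure.pi fun _ => bernoulliMeasure p

/-- The simple graph on `[n]` determined by an outcome of the edge indicators. -/
def graphOf {n : ℕ} (ω : Sym2 (Fin n) → Bool) : SimpleGraph (Fin n) :=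
  SimpleGraph.fromRel fun u v => ω s(u, v) = true

/-- `G` contains a (not necessarily induced) copy of `H`. -/
def ContainsCopy {α β : Type*} (H : SimpleGraph α) (G : SimpleGraph β) : Prop :=
  ∃ f : α → β, Function.Injective f ∧ ∀ ⦃u v⦄, H.Adj u v → G.Adj (f u) (f v)

/-- The maximum degree of a graph on a finite vertex type. -/
noncomputable def maxDeg {V : Type*} [Fintype V] (G : SimpleGraph V) : ℕ :=
  Finset.univ.sup fun v => (G.neighborSet v).ncard

/-- The maximum 0-density `m₀(H)`. -/
noncomputable def m0 {V : Type*} [Fintype V] (H : SimpleGraph V) : ℝ :=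
  sSup {x : ℝ | ∃ H' : H.Subgraph, H'.verts.Nonempty ∧
    x = (H'.edgeSet.ncard : ℝ) / (H'.verts.ncard : ℝ)}

/-- The maximum 1-density `m₁(H)`. -/
noncomputable def m1 {V : Type*} [Fintype V] (H : SimpleGraph V) : ℝ :=
  sSup {x : ℝ | ∃ H' : H.Subgraph, 1 < H'.verts.ncard ∧
    x = (H'.edgeSet.ncard : ℝ) / ((H'.verts.ncard : ℝ) - 1)}

/-- The maximum 2-density `m₂(H)`. -/
noncomputable def m2 {V : Type*} [Fintype V] (H : SimpleGraph V) : ℝ :=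
  sSup {x : ℝ | ∃ H' : H.Subgraph, 0 < H'.edgeSet.ncard ∧
    x = if 2 < H'.verts.ncard
      then ((H'.edgeSet.ncard : ℝ) - 1) / ((H'.verts.ncard : ℝ) - 2)
      else 1 / 2}

/-- The maximum Riordan-density `m_R(H)`. -/
noncomputable def mR {V : Type*} [Fintype V] (H : SimpleGraph V) : ℝ :=
  sSup {x : ℝ | ∃ H' : H.Subgraph, 2 < H'.verts.ncard ∧
    x = (H'.edgeSet.ncard : ℝ) / ((H'.verts.ncard : ℝ) - 2)}

/-- The local 1-density `m₁(x,H)` of `H` at the vertex `x`. -/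
noncomputable def m1At {V : Type*} [Fintype V] (H : SimpleGraph V) (x : V) : ℝ :=
  sSup {r : ℝ | ∃ H' : H.Subgraph, x ∈ H'.verts ∧ 1 < H'.verts.ncard ∧
    r = (H'.edgeSet.ncard : ℝ) / ((H'.verts.ncard : ℝ) - 1)}

/-- `H` is strictly 1-balanced: `H` itself is the unique maximiser of the 1-density. -/
def StrictlyOneBalanced {V : Type*} [Fintype V] (H : SimpleGraph V) : Prop :=
  ∀ H' : H.Subgraph, 1 < H'.verts.ncard → H' ≠ ⊤ →
    (H'.edgeSet.ncard : ℝ) / ((H'.verts.ncard : ℝ) - 1) <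
      (H.edgeSet.ncard : ℝ) / ((Fintype.card V : ℝ) - 1)

/-- `H` is vertex-1-balanced: the local 1-density at every vertex equals `m₁(H)`. -/
def VertexOneBalanced {V : Type*} [Fintype V] (H : SimpleGraph V) : Prop :=
  ∀ x : V, m1At H x = m1 H

/-- `G` (an `n`-vertex graph) contains an `H`-factor: `⌊n / v(H)⌋` pairwise vertex-disjoint
copies of `H`. -/
def HasFactor {V : Type*} [Fintype V] (H : SimpleGraph V) {n : ℕ}
    (G : SimpleGraph (Fin n)) : Prop :=
  ∃ f : Fin (n / Fintype.card V) × V → Fin n, Function.Injective f ∧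
    ∀ (i : Fin (n / Fintype.card V)) ⦃u v : V⦄, H.Adj u v → G.Adj (f (i, u)) (f (i, v))

/-- Vertices with a neighbour in `U`. -/
noncomputable def nbr {V : Type*} [Fintype V] (G : SimpleGraph V) (U : Finset V) : Finset V :=
  open Classical in Finset.univ.filter fun v => ∃ x ∈ U, G.Adj x v

/-- Any two disjoint sets of size at least `m` are joined by an edge. -/
def JoinedAt {V : Type*} (G : SimpleGraph V) (m : ℕ) : Prop :=
  ∀ X Y : Finset V, Disjoint X Y → m ≤ X.card → m ≤ Y.card → ∃ x ∈ X, ∃ y ∈ Y, G.Adj x y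

/-- Friedman–Pippenger / Haxell type expansion invariant. -/
def ExpInv {V : Type*} [Fintype V] [DecidableEq V] (G : SimpleGraph V) (m : ℕ) (S : Finset V)
    (w : V → ℕ) : Prop :=
  ∀ U : Finset V, U.Nonempty → U.card ≤ 2 * m → ∑ u ∈ U, w u ≤ (nbr G U \ S).card

set_option linter.unusedSectionVars false

section graph
variable {V : Type*} [Fintype V] [DecidableEq V] {G : SimpleGraph V} {m : ℕ}

lemma mem_nbr {U : Finset V} {v : V} : v ∈ nbr G U ↔ ∃ x ∈ U, G.Adj x v := by
  simp [nbr]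

lemma nbr_mono {U U' : Finset V} (h : U ⊆ U') : nbr G U ⊆ nbr G U' := by
  intro v hv
  rw [mem_nbr] at *
  obtain ⟨x, hx, hxv⟩ := hv
  exact ⟨x, h hx, hxv⟩

lemma nbr_union (U U' : Finset V) : nbr G (U ∪ U') = nbr G U ∪ nbr G U' := by
  ext v
  simp only [mem_nbr, Finset.mem_union]
  constructor
  · rintro ⟨x, hx | hx, h⟩
    · exact Or.inl ⟨x, hx, h⟩
    · exact Or.inr ⟨x, hx, h⟩
  · rintro (⟨x, hx, h⟩ | ⟨x, hx, h⟩)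
    · exact ⟨x, Or.inl hx, h⟩
    · exact ⟨x, Or.inr hx, h⟩

lemma nbr_big (hJ : JoinedAt G m) {U : Finset V} (hU : m ≤ U.card) :
    Fintype.card V + 1 ≤ (nbr G U).card + 2 * m := by
  obtain ⟨U', hU', hc⟩ := Finset.exists_subset_card_eq hU
  have h1 : (nbr G U').card ≤ (nbr G U).card := Finset.card_le_card (nbr_mono hU')
  set Y : Finset V := (Finset.univ \ nbr G U') \ U' with hY
  have hYm : Y.card < m := by
    by_contra hcon
    push Not at hcon
    obtain ⟨x, hx, y, hy, hxy⟩ := hJ U' Y Finset.disjoint_sdiff (by omega) hcon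
    simp only [hY, Finset.mem_sdiff] at hy
    exact hy.1.2 (mem_nbr.2 ⟨x, hx, hxy⟩)
  have h2 : (Finset.univ \ nbr G U').card ≤ Y.card + U'.card := by
    have := Finset.le_card_sdiff U' (Finset.univ \ nbr G U')
    rw [← hY] at this
    omega
  have h3 := Finset.le_card_sdiff (nbr G U') Finset.univ
  rw [Finset.card_univ] at h3
  omega

lemma tight_union {S : Finset V} {w : V → ℕ} (hI : ExpInv G m S w) {A B : Finset V}
    (hA : (nbr G A \ S).card = ∑ u ∈ A, w u) (hB : (nbr G B \ S).card = ∑ u ∈ B, w u)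
    (hAB : (A ∪ B).card ≤ 2 * m) :
    (nbr G (A ∪ B) \ S).card ≤ ∑ u ∈ A ∪ B, w u := by
  have h1 : nbr G (A ∪ B) \ S = (nbr G A \ S) ∪ (nbr G B \ S) := by
    rw [nbr_union, Finset.union_sdiff_distrib]
  have h2 := Finset.card_union_add_card_inter (nbr G A \ S) (nbr G B \ S)
  have h3 := Finset.sum_union_inter (s₁ := A) (s₂ := B) (f := w)
  have h4 : ∑ u ∈ A ∩ B, w u ≤ ((nbr G A \ S) ∩ (nbr G B \ S)).card := by
    rcases (A ∩ B).eq_empty_or_nonempty with he | hne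
    · simp [he]
    · refine (hI _ hne (le_trans (Finset.card_le_card ?_) hAB)).trans (Finset.card_le_card ?_)
      · exact Finset.inter_subset_left.trans Finset.subset_union_left
      · intro v hv
        rw [Finset.mem_sdiff] at hv
        simp only [Finset.mem_inter, Finset.mem_sdiff]
        exact ⟨⟨nbr_mono Finset.inter_subset_left hv.1, hv.2⟩,
          ⟨nbr_mono Finset.inter_subset_right hv.1, hv.2⟩⟩
  rw [h1]
  omega

lemma extend_inv (hJ : JoinedAt G m) {S : Finset V} {w : V → ℕ} {W : ℕ} (hI : ExpInv G m S w)
    (hw : ∀ u, w u ≤ W) (hm : 1 ≤ m)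
    (hs : S.card + 1 + 2 * m * W + 2 * m ≤ Fintype.card V) (x : V) (hx : 1 ≤ w x) :
    ∃ y, G.Adj x y ∧ y ∉ S ∧ ExpInv G m (insert y S) (Function.update w x (w x - 1)) := by
  by_contra hcon
  push Not at hcon
  have hsumW : ∀ U : Finset V, U.card ≤ 2 * m → ∑ u ∈ U, w u ≤ 2 * m * W := by
    intro U hU
    calc ∑ u ∈ U, w u ≤ ∑ u ∈ U, W := Finset.sum_le_sum fun u _ => hw u
      _ = U.card * W := by simp
      _ ≤ 2 * m * W := Nat.mul_le_mul_right _ hU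
  have hbig : ∀ U : Finset V, m ≤ U.card → U.card ≤ 2 * m →
      ∑ u ∈ U, w u + 2 ≤ (nbr G U \ S).card := by
    intro U h1 h2
    have := nbr_big hJ h1
    have h3 := hsumW U h2
    have h4 := Finset.le_card_sdiff S (nbr G U)
    omega
  have hupd : ∀ U : Finset V, ∑ u ∈ U, Function.update w x (w x - 1) u ≤ ∑ u ∈ U, w u := by
    intro U
    apply Finset.sum_le_sum
    intro u _
    by_cases h : u = x
    · subst h; simp
    · simp [h]
  have hupdx : ∀ U : Finset V, x ∈ U →
      ∑ u ∈ U, Function.update w x (w x - 1) u + 1 ≤ ∑ u ∈ U, w u := by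
    intro U hxU
    rw [Finset.sum_update_of_mem hxU, ← Finset.add_sum_erase _ _ hxU, Finset.sdiff_singleton_eq_erase]
    omega
  -- the critical sets
  have hcrit : ∀ y, G.Adj x y → y ∉ S → ∃ U : Finset V, U.card < m ∧ x ∉ U ∧
      y ∈ nbr G U ∧ (nbr G U \ S).card = ∑ u ∈ U, w u := by
    intro y hxy hyS
    have h := hcon y hxy hyS
    unfold ExpInv at h
    push Not at h
    obtain ⟨U, hne, hU, hlt⟩ := h
    have h1 : nbr G U \ insert y S = (nbr G U \ S).erase y := by
      ext v; simp only [Finset.mem_sdiff, Finset.mem_insert, Finset.mem_erase]; tauto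
    have h2 : (nbr G U \ S).card ≤ (nbr G U \ insert y S).card + 1 := by
      rw [h1]; have := Finset.pred_card_le_card_erase (s := nbr G U \ S) (a := y); omega
    have h3 := hupd U
    have h4 := hI U hne hU
    refine ⟨U, ?_, ?_, ?_, ?_⟩
    · by_contra hc
      have := hbig U (by omega) hU
      omega
    · intro hxU
      have := hupdx U hxU
      omega
    · by_contra hy
      have : (nbr G U \ S).erase y = nbr G U \ S := by
        apply Finset.erase_eq_of_notMem
        simp [hy]
      rw [h1, this] at hlt
      omega
    · omega
  choose! F hF using hcrit
  -- union of critical sets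
  have hun : ∀ Y : Finset V, (∀ y ∈ Y, G.Adj x y ∧ y ∉ S) →
      (Y.biUnion F).card < m ∧ (nbr G (Y.biUnion F) \ S).card = ∑ u ∈ Y.biUnion F, w u := by
    intro Y
    induction Y using Finset.induction_on with
    | empty =>
      intro _
      refine ⟨by simp; omega, ?_⟩
      have : nbr G (∅ : Finset V) = ∅ := by ext v; simp [mem_nbr]
      simp [this]
    | insert y Y hy ih =>
      intro hY
      obtain ⟨h1, h2⟩ := ih fun z hz => hY z (Finset.mem_insert_of_mem hz)
      obtain ⟨h3, h4, h5, h6⟩ := hF y (hY y (Finset.mem_insert_self _ _)).1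
        (hY y (Finset.mem_insert_self _ _)).2
      rw [Finset.biUnion_insert]
      have hc := Finset.card_union_le (F y) (Y.biUnion F)
      have h7 := tight_union hI h6 h2 (by omega)
      have h8 : (F y ∪ Y.biUnion F).card < m := by
        by_contra hcc
        have := hbig (F y ∪ Y.biUnion F) (by omega) (by omega)
        omega
      refine ⟨h8, le_antisymm h7 (hI _ ?_ (by omega))⟩
      obtain ⟨z, hz, -⟩ := mem_nbr.1 h5
      exact ⟨z, Finset.mem_union_left _ hz⟩
  set Y := nbr G {x} \ S with hYdef
  have hYmem : ∀ y ∈ Y, G.Adj x y ∧ y ∉ S := by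
    intro y hy
    simpa [hYdef, mem_nbr] using hy
  obtain ⟨h1, h2⟩ := hun Y hYmem
  have hxn : x ∉ Y.biUnion F := by
    rw [Finset.mem_biUnion]
    rintro ⟨y, hy, hxy⟩
    exact (hF y (hYmem y hy).1 (hYmem y hy).2).2.1 hxy
  have h3 := hI (insert x (Y.biUnion F)) (Finset.insert_nonempty _ _) (by
    rw [Finset.card_insert_of_notMem hxn]; omega)
  rw [Finset.sum_insert hxn] at h3
  have h4 : nbr G (insert x (Y.biUnion F)) \ S ⊆ nbr G (Y.biUnion F) \ S := by
    intro v hv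
    rw [Finset.mem_sdiff, mem_nbr] at hv
    obtain ⟨⟨z, hz, hzv⟩, hvS⟩ := hv
    rw [Finset.mem_sdiff]
    refine ⟨?_, hvS⟩
    rcases Finset.mem_insert.1 hz with rfl | hz
    · have hvY : v ∈ Y := by simp [hYdef, mem_nbr, hzv, hvS]
      exact nbr_mono (Finset.subset_biUnion_of_mem F hvY) (hF v hzv hvS).2.2.1
    · exact mem_nbr.2 ⟨z, hz, hzv⟩
  have h5 := Finset.card_le_card h4
  omega

end graph
section treepar
/-- every tree has a parent function -/
lemma exists_par {n : ℕ} {T : SimpleGraph (Fin n)} (hT : T.IsTree) (root : Fin n) :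
    ∃ (par : Fin n → Fin n) (rk : Fin n → ℕ), (∀ u, u ≠ root → rk (par u) < rk u) ∧
      (∀ u, u ≠ root → T.Adj u (par u)) ∧
      (∀ u v, T.Adj u v → (u ≠ root ∧ par u = v) ∨ (v ≠ root ∧ par v = u)) := by
  classical
  have hex : ∀ u, ∃ p : Fin n, u ≠ root → (T.Adj u p ∧ T.dist root u = T.dist root p + 1) := by
    intro u
    by_cases hu : u = root
    · exact ⟨u, fun h => absurd hu h⟩
    obtain ⟨p, hp⟩ := hT.connected.exists_walk_length_eq_dist u root
    cases p with
    | nil => exact absurd rfl hu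
    | cons h q =>
      rename_i v
      refine ⟨v, fun _ => ⟨h, ?_⟩⟩
      have h1 := SimpleGraph.dist_le q
      rw [SimpleGraph.Walk.length_cons] at hp
      have h2 := hT.dist_eq_dist_add_one_of_adj root h
      rw [SimpleGraph.dist_comm (u := u)] at hp
      rw [SimpleGraph.dist_comm (u := v)] at h1
      omega
  choose par hpar using hex
  have huniq : ∀ u v, u ≠ root → T.Adj u v → T.dist root u = T.dist root v + 1 → par u = v := by
    intro u v hu huv hd
    have key : ∀ v (huv : T.Adj u v), T.dist root u = T.dist root v + 1 →
        ∃ p : T.Walk u root, p.IsPath ∧ p.snd = v := by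
      intro v huv hd
      obtain ⟨q, hq⟩ := hT.connected.exists_walk_length_eq_dist v root
      refine ⟨SimpleGraph.Walk.cons huv q, ?_, by simp⟩
      apply SimpleGraph.Walk.isPath_of_length_eq_dist
      rw [SimpleGraph.Walk.length_cons, hq, SimpleGraph.dist_comm, ← hd, SimpleGraph.dist_comm]
    obtain ⟨p, hp, hp'⟩ := key v huv hd
    obtain ⟨q, hq, hq'⟩ := key (par u) (hpar u hu).1 (hpar u hu).2
    have := (hT.existsUnique_path u root).unique hp hq
    rw [← hp', ← hq', this]
  refine ⟨par, fun u => T.dist root u, fun u hu => by have := (hpar u hu).2; dsimp only; omega,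
    fun u hu => (hpar u hu).1, ?_⟩
  intro u v huv
  rcases hT.dist_eq_dist_add_one_of_adj root huv with h | h
  · have hu : u ≠ root := by rintro rfl; simp at h
    exact Or.inl ⟨hu, huniq u v hu huv h⟩
  · have hv : v ≠ root := by rintro rfl; simp at h
    exact Or.inr ⟨hv, huniq v u hv huv.symm h⟩
end treepar
section embedding

/-- children of `t` inside `X` -/
def kids {τ : Type*} [DecidableEq τ] (par : τ → τ) (root : τ) (X : Finset τ) (t : τ) : Finset τ :=
  X.filter fun u => u ≠ root ∧ par u = t

/-- parent-closed sets -/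
def PClosed {τ : Type*} (par : τ → τ) (root : τ) (S : Finset τ) : Prop :=
  root ∈ S ∧ ∀ u ∈ S, u ≠ root → par u ∈ S

/-- Partial embedding of the parent-closed set `S` with the expansion invariant. -/
def GoodEmb {V τ : Type*} [Fintype V] [DecidableEq V] [DecidableEq τ] (G : SimpleGraph V) (m : ℕ)
    (par : τ → τ) (root : τ) (I : Finset τ) (K D : ℕ) (S : Finset τ) (φ : τ → V) : Prop :=
  PClosed par root S ∧ Set.InjOn φ S ∧ (∀ u ∈ S, u ≠ root → G.Adj (φ u) (φ (par u))) ∧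
  ∃ w : V → ℕ, (∀ y, w y ≤ D + K) ∧ (∀ y, y ∉ S.image φ → D + K ≤ w y) ∧
    (∀ t ∈ S, D + (kids par root (I \ S) t).card ≤ w (φ t)) ∧ ExpInv G m (S.image φ) w

variable {V τ : Type*} [Fintype V] [DecidableEq V] [DecidableEq τ] {G : SimpleGraph V} {m : ℕ}
  {par : τ → τ} {root : τ} {I : Finset τ} {K D : ℕ} {S : Finset τ} {φ : τ → V}

lemma kids_mono {X Y : Finset τ} (h : X ⊆ Y) (t : τ) :
    kids par root X t ⊆ kids par root Y t := Finset.filter_subset_filter _ h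

lemma GoodEmb.grow (hJ : JoinedAt G m) (hm : 1 ≤ m) (hK : ∀ t, (kids par root I t).card ≤ K)
    (h : GoodEmb G m par root I K D S φ) {u : τ} (hu : u ∈ I) (huS : u ∉ S)
    (hur : u ≠ root) (hpu : par u ∈ S)
    (hs : S.card + 1 + 2 * m * (D + K) + 2 * m ≤ Fintype.card V) :
    ∃ φ', GoodEmb G m par root I K D (insert u S) φ' ∧ Set.EqOn φ' φ S := by
  obtain ⟨hcl, hinj, hadj, w, hw1, hw2, hw3, hI⟩ := h
  have hpk : u ∈ kids par root (I \ S) (par u) := by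
    simp [kids, hu, huS, hur]
  have hx : 1 ≤ w (φ (par u)) := by
    have h1 := hw3 _ hpu
    have h2 := Finset.card_pos.2 ⟨u, hpk⟩
    omega
  obtain ⟨y, hxy, hyS, hI'⟩ := extend_inv hJ hI hw1 hm (by
    rw [Finset.card_image_of_injOn hinj]; exact hs) (φ (par u)) hx
  have heq : Set.EqOn (Function.update φ u y) φ S := by
    intro t ht
    have : t ≠ u := by rintro rfl; exact huS ht
    simp [this]
  have hu' : Function.update φ u y u = y := by simp
  have hyS' : ∀ t ∈ S, φ t ≠ y := fun t ht hty => hyS (Finset.mem_image.2 ⟨t, ht, hty⟩)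
  have himg : (insert u S).image (Function.update φ u y) = insert y (S.image φ) := by
    rw [Finset.image_insert, hu']
    congr 1
    exact Finset.image_congr heq
  refine ⟨Function.update φ u y, ⟨⟨Finset.mem_insert_of_mem hcl.1, ?_⟩, ?_, ?_, ?_⟩, heq⟩
  · intro v hv hvr
    rcases Finset.mem_insert.1 hv with rfl | hv
    · exact Finset.mem_insert_of_mem hpu
    · exact Finset.mem_insert_of_mem (hcl.2 v hv hvr)
  · rw [Finset.coe_insert, Set.injOn_insert (by exact_mod_cast huS)]
    refine ⟨heq.injOn_iff.2 hinj, ?_⟩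
    rintro ⟨t, ht, hty⟩
    rw [hu', heq ht] at hty
    exact hyS' t ht hty
  · intro v hv hvr
    rcases Finset.mem_insert.1 hv with rfl | hv
    · rw [hu', heq hpu]; exact hxy.symm
    · rw [heq hv, heq (hcl.2 v hv hvr)]; exact hadj v hv hvr
  · refine ⟨Function.update w (φ (par u)) (w (φ (par u)) - 1), ?_, ?_, ?_, ?_⟩
    · intro z
      by_cases hz : z = φ (par u)
      · subst hz; simp; have := hw1 (φ (par u)); omega
      · simp [hz, hw1]
    · intro z hz
      rw [himg, Finset.mem_insert, not_or] at hz
      have : z ≠ φ (par u) := by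
        rintro rfl; exact hz.2 (Finset.mem_image_of_mem _ hpu)
      simp only [Function.update_of_ne this]
      exact hw2 z hz.2
    · intro t ht
      rcases Finset.mem_insert.1 ht with rfl | ht
      · rw [hu', Function.update_of_ne (hyS' _ hpu).symm]
        have h1 := hw2 y hyS
        have h2 := (Finset.card_le_card (kids_mono (par := par) (root := root)
          (Finset.sdiff_subset : I \ insert t S ⊆ I) t)).trans (hK t)
        omega
      · rw [heq ht]
        by_cases htp : t = par u
        · subst htp
          simp only [Function.update_self]
          have h1 := hw3 _ ht
          have h2 : (kids par root (I \ insert u S) (par u)).card <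
              (kids par root (I \ S) (par u)).card := by
            apply Finset.card_lt_card
            refine ⟨kids_mono (Finset.sdiff_subset_sdiff subset_rfl (Finset.subset_insert _ _)) _,
              fun hc => ?_⟩
            have := hc hpk
            simp [kids] at this
          omega
        · have : φ t ≠ φ (par u) := fun hc => htp (hinj ht hpu hc)
          rw [Function.update_of_ne this]
          have h1 := hw3 _ ht
          have h2 := Finset.card_le_card (kids_mono (par := par) (root := root)
            (Finset.sdiff_subset_sdiff (subset_refl I) (Finset.subset_insert u S)) t)
          omega
    · rw [himg]; exact hI'

lemma GoodEmb.growTo (hJ : JoinedAt G m) (hm : 1 ≤ m)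
    {rk : τ → ℕ} (hrk : ∀ u ∈ I, u ≠ root → rk (par u) < rk u)
    (hK : ∀ t, (kids par root I t).card ≤ K) {S' : Finset τ} (hS' : PClosed par root S')
    (hS'I : S' ⊆ I)
    (hs : S'.card + 2 * m * (D + K) + 2 * m ≤ Fintype.card V) :
    ∀ (j : ℕ) (S : Finset τ) (φ : τ → V), (S' \ S).card = j → S ⊆ S' →
      GoodEmb G m par root I K D S φ →
      ∃ φ', GoodEmb G m par root I K D S' φ' ∧ Set.EqOn φ' φ S := by
  intro j
  induction j with
  | zero =>
    intro S φ hj hSS h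
    have : S' = S := by
      apply subset_antisymm _ hSS
      rw [← Finset.sdiff_eq_empty_iff_subset]; exact Finset.card_eq_zero.1 hj
    subst this
    exact ⟨φ, h, fun _ _ => rfl⟩
  | succ j ih =>
    intro S φ hj hSS h
    have hne : (S' \ S).Nonempty := by rw [← Finset.card_pos]; omega
    obtain ⟨u, hu, hmin⟩ := Finset.exists_min_image (S' \ S) rk hne
    rw [Finset.mem_sdiff] at hu
    have hur : u ≠ root := by rintro rfl; exact hu.2 h.1.1
    have hpu : par u ∈ S := by
      by_contra hc
      have h1 := hmin (par u) (by rw [Finset.mem_sdiff]; exact ⟨hS'.2 u hu.1 hur, hc⟩)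
      have h2 := hrk u (hS'I hu.1) hur
      omega
    have hsub : insert u S ⊆ S' := Finset.insert_subset hu.1 hSS
    have hc := Finset.card_le_card hsub
    rw [Finset.card_insert_of_notMem hu.2] at hc
    obtain ⟨φ1, h1, he1⟩ := h.grow hJ hm hK (hS'I hu.1) hu.2 hur hpu (by omega)
    obtain ⟨φ2, h2, he2⟩ := ih (insert u S) φ1 (by
      have : S' \ insert u S = (S' \ S).erase u := by
        ext v; simp only [Finset.mem_sdiff, Finset.mem_insert, Finset.mem_erase]; tauto
      rw [this, Finset.card_erase_of_mem (by simp [hu.1, hu.2])]; omega) hsub h1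
    refine ⟨φ2, h2, fun t ht => ?_⟩
    rw [he2 (by simp; exact Or.inr ht), he1 ht]

lemma GoodEmb.drop (h : GoodEmb G m par root I K D S φ) {D' : ℕ} (hD : D' ≤ D) :
    GoodEmb G m par root I K D' S φ := by
  obtain ⟨hcl, hinj, hadj, w, hw1, hw2, hw3, hI⟩ := h
  refine ⟨hcl, hinj, hadj, fun y => w y - (D - D'), ?_, ?_, ?_, ?_⟩
  · intro y; have := hw1 y; dsimp only; omega
  · intro y hy; have := hw2 y hy; dsimp only; omega
  · intro t ht; have := hw3 t ht; dsimp only; omega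
  · intro U h1 h2
    refine le_trans (Finset.sum_le_sum fun u _ => Nat.sub_le _ _) (hI U h1 h2)

/-- every vertex has many unused neighbours -/
lemma GoodEmb.deg (h : GoodEmb G m par root I K D S φ) (hm : 1 ≤ m) (v : V) :
    D ≤ (nbr G {v} \ S.image φ).card := by
  obtain ⟨hcl, hinj, hadj, w, hw1, hw2, hw3, hI⟩ := h
  have h1 := hI {v} (Finset.singleton_nonempty _) (by simp; omega)
  rw [Finset.sum_singleton] at h1
  refine le_trans ?_ h1
  by_cases hv : v ∈ S.image φ
  · obtain ⟨t, ht, rfl⟩ := Finset.mem_image.1 hv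
    have := hw3 t ht; omega
  · have := hw2 v hv; omega

lemma GoodEmb.cover (hJ : JoinedAt G m) (hm : 1 ≤ m) (hK : ∀ t, (kids par root I t).card ≤ K)
    (h : GoodEmb G m par root I K (D + 2) S φ) (hD : 2 * m ≤ D) {p : τ}
    (hpr : p ≠ root) (hpS : p ∉ S) (hq : par p ∉ S) (hqr : par p ≠ root)
    (hqq : par (par p) ∈ S) (hpq : p ≠ par p) (q : V) :
    ∃ φ', GoodEmb G m par root I K D (insert p (insert (par p) S)) φ' ∧ Set.EqOn φ' φ S ∧
      G.Adj q (φ' p) := by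
  have hd1 := h.deg hm (φ (par (par p)))
  have hd2 := h.deg hm q
  obtain ⟨hcl, hinj, hadj, w, hw1, hw2, hw3, hI⟩ := h
  obtain ⟨X, hX, hXc⟩ := Finset.exists_subset_card_eq (n := m) (show m ≤ _ by
    exact le_trans (by omega) hd1)
  have hY : m ≤ ((nbr G {q} \ S.image φ) \ X).card := by
    have := Finset.le_card_sdiff X (nbr G {q} \ S.image φ)
    omega
  obtain ⟨b, hb, b', hb', hbb⟩ := hJ X _ Finset.disjoint_sdiff hXc.ge hY
  have hb0 := hX hb
  simp only [Finset.mem_sdiff, mem_nbr, Finset.mem_singleton, exists_eq_left] at hb0 hb'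
  set t := par p with ht
  set φ' := Function.update (Function.update φ t b) p b' with hφ'
  have hp' : φ' p = b' := by simp [hφ']
  have ht' : φ' t = b := by simp [hφ', hpq.symm]
  have heq : Set.EqOn φ' φ S := by
    intro s hs
    have h1 : s ≠ p := by rintro rfl; exact hpS hs
    have h2 : s ≠ t := by rintro rfl; exact hq hs
    simp [hφ', h1, h2]
  have himg : (insert p (insert t S)).image φ' = insert b' (insert b (S.image φ)) := by
    rw [Finset.image_insert, Finset.image_insert, hp', ht']
    congr 2
    exact Finset.image_congr heq
  refine ⟨φ', ⟨⟨by simp [hcl.1], ?_⟩, ?_, ?_, ?_⟩, heq, by rw [hp']; exact hb'.1.1⟩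
  · intro v hv hvr
    simp only [Finset.mem_insert] at hv ⊢
    rcases hv with rfl | rfl | hv
    · exact Or.inr (Or.inl rfl)
    · exact Or.inr (Or.inr hqq)
    · exact Or.inr (Or.inr (hcl.2 v hv hvr))
  · rw [Finset.coe_insert, Finset.coe_insert, Set.injOn_insert, Set.injOn_insert]
    · refine ⟨⟨heq.injOn_iff.2 hinj, ?_⟩, ?_⟩
      · rintro ⟨s, hs, hst⟩
        rw [ht', heq hs] at hst
        exact hb0.2 (Finset.mem_image.2 ⟨s, hs, hst⟩)
      · rintro ⟨s, hs, hst⟩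
        rw [hp'] at hst
        rcases hs with rfl | hs
        · rw [ht'] at hst; rw [hst] at hbb; exact G.loopless.irrefl _ hbb
        · rw [heq hs] at hst
          exact hb'.1.2 (Finset.mem_image.2 ⟨s, hs, hst⟩)
    · exact_mod_cast hq
    · rintro (h | h)
      · exact hpq h
      · exact hpS h
  · intro v hv hvr
    simp only [Finset.mem_insert] at hv
    rcases hv with rfl | rfl | hv
    · rw [hp', ← ht, ht']; exact hbb.symm
    · rw [ht', heq hqq]; exact hb0.1.symm
    · rw [heq hv, heq (hcl.2 v hv hvr)]; exact hadj v hv hvr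
  · refine ⟨fun y => w y - 2, ?_, ?_, ?_, ?_⟩
    · intro y; have := hw1 y; dsimp only; omega
    · intro y hy
      rw [himg, Finset.mem_insert, Finset.mem_insert, not_or, not_or] at hy
      have := hw2 y hy.2.2; dsimp only; omega
    · intro s hs
      dsimp only
      simp only [Finset.mem_insert] at hs
      have h2 := (Finset.card_le_card (kids_mono (par := par) (root := root)
          (Finset.sdiff_subset : I \ insert p (insert t S) ⊆ I) s)).trans (hK s)
      rcases hs with rfl | rfl | hs
      · rw [hp']; have := hw2 b' hb'.1.2; omega
      · rw [ht']; have := hw2 b hb0.2; omega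
      · rw [heq hs]
        have h1 := hw3 s hs
        have h2 := Finset.card_le_card (kids_mono (par := par) (root := root)
          (Finset.sdiff_subset_sdiff (subset_refl I)
            ((Finset.subset_insert t S).trans (Finset.subset_insert p _))) s)
        omega
    · intro U h1 h2
      have h3 := hI U h1 h2
      rw [himg]
      have h4 : nbr G U \ insert b' (insert b (S.image φ)) =
          ((nbr G U \ S.image φ).erase b).erase b' := by
        ext v; simp only [Finset.mem_sdiff, Finset.mem_insert, Finset.mem_erase]; tauto
      have h5 := Finset.pred_card_le_card_erase (s := nbr G U \ S.image φ) (a := b)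
      have h6 := Finset.pred_card_le_card_erase (s := (nbr G U \ S.image φ).erase b) (a := b')
      rw [h4]
      obtain ⟨u, hu⟩ := h1
      have hwu : 2 ≤ w u := by
        by_cases hv : u ∈ S.image φ
        · obtain ⟨t, ht, rfl⟩ := Finset.mem_image.1 hv
          have := hw3 t ht; omega
        · have := hw2 u hv; omega
      have h7 : ∑ v ∈ U, (w v - 2) + 2 ≤ ∑ v ∈ U, w v := by
        rw [← Finset.add_sum_erase _ _ hu, ← Finset.add_sum_erase _ _ hu]
        have : ∑ v ∈ U.erase u, (w v - 2) ≤ ∑ v ∈ U.erase u, w v :=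
          Finset.sum_le_sum fun _ _ => Nat.sub_le _ _
        omega
      dsimp only
      omega

lemma GoodEmb.init (hJ : JoinedAt G m) (hm : 1 ≤ m) (hK : ∀ t, (kids par root I t).card ≤ K)
    (hexp : ∀ U : Finset V, U.Nonempty → U.card < m → (D + K + 1) * U.card ≤ (nbr G U).card)
    (hs : 2 * m * (D + K) + 2 * m ≤ Fintype.card V) (v : V) :
    GoodEmb G m par root I K D {root} (fun _ => v) := by
  refine ⟨⟨by simp, by simp⟩, by simp, by simp, fun _ => D + K, fun _ => le_rfl,
    fun _ _ => le_rfl, ?_, ?_⟩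
  · intro t _
    have h2 := (Finset.card_le_card (kids_mono (par := par) (root := root)
          (Finset.sdiff_subset : I \ {root} ⊆ I) t)).trans (hK t)
    dsimp only
    omega
  · intro U h1 h2
    have h3 := Finset.le_card_sdiff ((({root} : Finset τ)).image fun _ => v) (nbr G U)
    have h4 : (({root} : Finset τ).image fun _ => v).card = 1 := by simp
    rw [Finset.sum_const, smul_eq_mul]
    have h6 := Finset.card_pos.2 h1
    by_cases hU : U.card < m
    · have h5 := hexp U h1 hU
      have : (D + K + 1) * U.card = U.card * (D + K) + U.card := by ring
      omega
    · have h5 := nbr_big hJ (not_lt.1 hU)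
      have := Nat.mul_le_mul_right (D + K) h2
      omega

end embedding
section hamilton

variable {V : Type*} [Fintype V] [DecidableEq V] {G : SimpleGraph V} {m : ℕ}

/-- a path from `a` to `b` inside `W` -/
def PathIn (G : SimpleGraph V) (W : Finset V) (a b : V) (l : List V) : Prop :=
  l.IsChain G.Adj ∧ l.Nodup ∧ (∀ v ∈ l, v ∈ W) ∧ l.head? = some a ∧ l.getLast? = some b

lemma PathIn.insertSeg {W : Finset V} {a b : V} {l1 l2 seg : List V} {p p' u u' : V}
    (h : PathIn G W a b (l1 ++ l2)) (h1 : l1.getLast? = some p) (h2 : l2.head? = some p')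
    (hc : seg.IsChain G.Adj) (hn : seg.Nodup) (hW : ∀ v ∈ seg, v ∈ W)
    (hd : ∀ v ∈ seg, v ∉ l1 ++ l2) (hu : seg.head? = some u) (hu' : seg.getLast? = some u')
    (ha : G.Adj p u) (hb : G.Adj u' p') :
    PathIn G W a b (l1 ++ (seg ++ l2)) := by
  obtain ⟨c1, c2, c3, c4, c5⟩ := h
  rw [List.isChain_append] at c1
  rw [List.nodup_append] at c2
  have hl1 : l1 ≠ [] := by rintro rfl; simp at h1
  have hl2 : l2 ≠ [] := by rintro rfl; simp at h2
  refine ⟨?_, ?_, ?_, ?_, ?_⟩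
  · rw [List.isChain_append, List.isChain_append]
    refine ⟨c1.1, ⟨hc, c1.2.1, ?_⟩, ?_⟩
    · intro x hx y hy
      rw [hu'] at hx; rw [h2] at hy
      simp at hx hy; subst hx; subst hy; exact hb
    · intro x hx y hy
      rw [h1] at hx; rw [List.head?_append, hu] at hy
      simp at hx hy; subst hx; subst hy; exact ha
  · rw [List.nodup_append, List.nodup_append]
    refine ⟨c2.1, ⟨hn, c2.2.1, ?_⟩, ?_⟩
    · rintro x hx y hy rfl
      exact hd x hx (List.mem_append_right _ hy)
    · rintro x hx y hy rfl
      rcases List.mem_append.1 hy with hy | hy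
      · exact hd x hy (List.mem_append_left _ hx)
      · exact c2.2.2 x hx x hy rfl
  · intro v hv
    simp only [List.mem_append] at hv c3
    rcases hv with hv | hv | hv
    · exact c3 v (Or.inl hv)
    · exact hW v hv
    · exact c3 v (Or.inr hv)
  · rw [List.head?_append_of_ne_nil _ hl1] at c4 ⊢
    exact c4
  · rw [List.getLast?_append_of_ne_nil _ hl2] at c5
    rw [List.getLast?_append_of_ne_nil _ (by simp [hl2]), List.getLast?_append_of_ne_nil _ hl2]
    exact c5

lemma PathIn.rotate {W : Finset V} {a b : V} {l1 mid l2 : List V} {p p' s s' v : V}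
    (h : PathIn G W a b (l1 ++ (mid ++ l2))) (h1 : l1.getLast? = some p)
    (h2 : mid.head? = some s) (h3 : mid.getLast? = some p') (h4 : l2.head? = some s')
    (hvW : v ∈ W) (hv : v ∉ l1 ++ (mid ++ l2)) (hp : G.Adj v p) (hp' : G.Adj v p')
    (hs : G.Adj s s') :
    PathIn G W a b (l1 ++ ((v :: mid.reverse) ++ l2)) := by
  obtain ⟨c1, c2, c3, c4, c5⟩ := h
  have hl1 : l1 ≠ [] := by rintro rfl; simp at h1
  have hl2 : l2 ≠ [] := by rintro rfl; simp at h4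
  have hperm : (l1 ++ ((v :: mid.reverse) ++ l2)).Perm (v :: (l1 ++ (mid ++ l2))) := by
    refine List.perm_middle.trans ?_
    refine List.Perm.cons _ ?_
    exact List.Perm.append_left _ (List.Perm.append_right _ (List.reverse_perm _))
  rw [List.isChain_append, List.isChain_append] at c1
  refine ⟨?_, ?_, ?_, ?_, ?_⟩
  · rw [List.isChain_append, List.isChain_append, List.isChain_cons]
    refine ⟨c1.1, ⟨⟨?_, ?_⟩, c1.2.1.2.1, ?_⟩, ?_⟩
    · intro y hy
      rw [List.head?_reverse, h3] at hy
      simp at hy; subst hy; exact hp'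
    · rw [List.isChain_reverse]
      exact c1.2.1.1.imp fun x y hxy => hxy.symm
    · intro x hx y hy
      rw [List.getLast?_cons, List.getLast?_reverse, h2] at hx
      rw [h4] at hy
      simp at hx hy; subst hx; subst hy; exact hs
    · intro x hx y hy
      rw [h1] at hx
      simp at hx hy; subst hx; subst hy; exact hp.symm
  · rw [hperm.nodup_iff, List.nodup_cons]
    exact ⟨hv, c2⟩
  · intro x hx
    rw [hperm.mem_iff, List.mem_cons] at hx
    rcases hx with rfl | hx
    · exact hvW
    · exact c3 x hx
  · rw [List.head?_append_of_ne_nil _ hl1] at c4 ⊢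
    exact c4
  · rw [List.getLast?_append_of_ne_nil _ (by simp [hl2]), List.getLast?_append_of_ne_nil _ hl2] at c5
    rw [List.getLast?_append_of_ne_nil _ (by simp), List.getLast?_append_of_ne_nil _ hl2]
    exact c5

/-- connect two vertices through a set -/
lemma connect4 (hJ : JoinedAt G m) (Z : Finset V) {u u' : V} (hne : u ≠ u')
    (hu : 2 * m + 2 ≤ (nbr G {u} ∩ Z).card) (hu' : 2 * m + 2 ≤ (nbr G {u'} ∩ Z).card) :
    ∃ x ∈ Z, ∃ y ∈ Z, [u, x, y, u'].IsChain G.Adj ∧ [u, x, y, u'].Nodup := by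
  have e1 : m ≤ ((nbr G {u} ∩ Z).erase u').card := by
    have := Finset.pred_card_le_card_erase (s := nbr G {u} ∩ Z) (a := u'); omega
  obtain ⟨X, hX, hXc⟩ := Finset.exists_subset_card_eq e1
  have e2 : m ≤ (((nbr G {u'} ∩ Z).erase u) \ X).card := by
    have := Finset.pred_card_le_card_erase (s := nbr G {u'} ∩ Z) (a := u)
    have := Finset.le_card_sdiff X ((nbr G {u'} ∩ Z).erase u)
    omega
  obtain ⟨x, hx, y, hy, hxy⟩ := hJ X _ Finset.disjoint_sdiff hXc.ge e2
  have hx' := hX hx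
  simp only [Finset.mem_erase, Finset.mem_inter, mem_nbr, Finset.mem_singleton, exists_eq_left,
    Finset.mem_sdiff] at hx' hy
  refine ⟨x, hx'.2.2, y, hy.1.2.2, ?_, ?_⟩
  · simp [hx'.2.1, hxy, hy.1.2.1.symm]
  · have n1 := hx'.2.1.ne
    have n2 := hxy.ne
    have n3 := hy.1.2.1.ne
    simp
    exact ⟨⟨n1, fun h => hy.1.1 h.symm, hne⟩, ⟨n2, hx'.1⟩, n3.symm⟩

lemma ham_path (hJ : JoinedAt G m) (hm : 1 ≤ m) (W : Finset V) {a b : V} (hab : a ≠ b)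
    (ha : a ∈ W) (hb : b ∈ W) (hdeg : ∀ v ∈ W, 4 * m + 6 ≤ (nbr G {v} ∩ W).card) :
    ∃ l : List V, PathIn G W a b l ∧ ∀ v ∈ W, v ∈ l := by
  have hex : ∃ N : ℕ, ∃ l, PathIn G W a b l ∧ W.card - l.length = N := by
    obtain ⟨x, hx, y, hy, hc, hn⟩ := connect4 hJ W hab (by have := hdeg a ha; omega)
      (by have := hdeg b hb; omega)
    refine ⟨_, [a, x, y, b], ⟨hc, hn, ?_, rfl, rfl⟩, rfl⟩
    simp [ha, hb, hx, hy]
  classical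
  obtain ⟨l, hl, hlN⟩ := Nat.find_spec hex
  have hlen : ∀ l, PathIn G W a b l → l.length ≤ W.card := by
    intro l hl
    rw [← List.toFinset_card_of_nodup hl.2.1]
    exact Finset.card_le_card fun v hv => hl.2.2.1 v (List.mem_toFinset.1 hv)
  have hmax : ∀ l', PathIn G W a b l' → l'.length ≤ l.length := by
    intro l' hl'
    have h1 := Nat.find_min' hex ⟨l', hl', rfl⟩
    have h2 := hlen l' hl'
    have h3 := hlen l hl
    omega
  refine ⟨l, hl, ?_⟩
  by_contra hcon
  push Not at hcon
  obtain ⟨v0, hv0, hv0l⟩ := hcon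
  set Z := W \ l.toFinset with hZ
  set g : ℕ → V := fun i => l.getD i a with hg
  have hgi : ∀ i (hi : i < l.length), g i = l[i] := by
    intro i hi; simp [hg, hi]
  have hginj : ∀ i j, i < l.length → j < l.length → g i = g j → i = j := by
    intro i j hi hj hij
    rw [hgi i hi, hgi j hj] at hij
    exact (List.Nodup.getElem_inj_iff hl.2.1).1 hij
  have hgmem : ∀ i, i < l.length → g i ∈ l := by
    intro i hi; rw [hgi i hi]; exact List.getElem_mem hi
  have hgsurj : ∀ x ∈ l, ∃ i, i < l.length ∧ g i = x := by
    intro x hx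
    obtain ⟨i, hi, hix⟩ := List.getElem_of_mem hx
    exact ⟨i, hi, by rw [hgi i hi, hix]⟩
  have htake : ∀ i, i < l.length → (l.take (i + 1)).getLast? = some (g i) := by
    intro i hi
    rw [List.getLast?_take, hgi i hi]; simp [hi]
  have hdrop : ∀ i, i < l.length → (l.drop i).head? = some (g i) := by
    intro i hi
    rw [List.head?_drop, hgi i hi]; simp [hi]
  -- first claim
  have hfew : ∀ v ∈ Z, (nbr G {v} ∩ l.toFinset).card ≤ 2 * m := by
    intro v hv
    rw [hZ, Finset.mem_sdiff, List.mem_toFinset] at hv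
    by_contra hc
    push Not at hc
    set J := (Finset.range (l.length - 1)).filter fun i => G.Adj v (g i) with hJd
    have hJc : 2 * m ≤ J.card := by
      have hsub : nbr G {v} ∩ l.toFinset ⊆ insert (g (l.length - 1)) (J.image g) := by
        intro x hx
        simp only [Finset.mem_inter, mem_nbr, Finset.mem_singleton, exists_eq_left,
          List.mem_toFinset] at hx
        obtain ⟨i, hi, rfl⟩ := hgsurj x hx.2
        by_cases hi' : i = l.length - 1
        · rw [hi']; simp
        · apply Finset.mem_insert_of_mem
          apply Finset.mem_image_of_mem
          simp only [hJd, Finset.mem_filter, Finset.mem_range]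
          exact ⟨by omega, hx.1⟩
      have h1 := Finset.card_le_card hsub
      have h2 := Finset.card_insert_le (g (l.length - 1)) (J.image g)
      have h3 := Finset.card_image_le (s := J) (f := g)
      omega
    have hJm : ∀ i ∈ J, i + 1 < l.length ∧ G.Adj v (g i) := by
      intro i hi
      simp only [hJd, Finset.mem_filter, Finset.mem_range] at hi
      exact ⟨by omega, hi.2⟩
    obtain ⟨J1, hJ1, hJ1c⟩ := Finset.exists_subset_card_eq (show m ≤ J.card by omega)
    have hJ2c : m ≤ (J \ J1).card := by
      have := Finset.le_card_sdiff J1 J; omega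
    have hinj : Set.InjOn (fun i => g (i + 1)) (J : Set ℕ) := by
      intro i hi j hj hij
      have := hginj _ _ (hJm i hi).1 (hJm j hj).1 hij
      omega
    have key : ∀ i ∈ J, ∀ j ∈ J, i < j → ¬ G.Adj (g (i + 1)) (g (j + 1)) := by
      intro i hi j hj hij hadj
      have hi' := hJm i hi
      have hj' := hJm j hj
      have hsplit : l = l.take (i + 1) ++ ((l.take (j + 1)).drop (i + 1) ++ l.drop (j + 1)) := by
        conv_lhs => rw [← List.take_append_drop (j + 1) l]
        conv_lhs => rw [← List.take_append_drop (i + 1) (l.take (j + 1))]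
        rw [List.take_take, List.append_assoc, min_eq_left (by omega)]
      have hP := hl
      rw [hsplit] at hP
      have hvl := hv.2
      rw [hsplit] at hvl
      have h1 : ((l.take (j + 1)).drop (i + 1)).head? = some (g (i + 1)) := by
        rw [List.head?_drop, List.getElem?_take, hgi _ hi'.1]
        simp [hij, hi'.1]
      have h2 : ((l.take (j + 1)).drop (i + 1)).getLast? = some (g j) := by
        rw [List.getLast?_drop, htake j (by omega)]
        rw [if_neg]
        rw [List.length_take]; omega
      have hR := hP.rotate (htake i (by omega)) h1 h2 (hdrop (j + 1) hj'.1) hv.1 hvl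
        hi'.2 hj'.2 hadj
      have h3 := hmax _ hR
      have h4 := congrArg List.length hsplit
      simp only [List.length_append, List.length_cons, List.length_reverse] at h3 h4
      omega
    obtain ⟨x, hx, y, hy, hxy⟩ := hJ (J1.image fun i => g (i + 1)) ((J \ J1).image fun i => g (i + 1))
      (by
        rw [Finset.disjoint_left]
        intro x hx hx'
        obtain ⟨i, hi, rfl⟩ := Finset.mem_image.1 hx
        obtain ⟨j, hj, hij⟩ := Finset.mem_image.1 hx'
        rw [Finset.mem_sdiff] at hj
        have := hinj hj.1 (hJ1 hi) hij
        subst this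
        exact hj.2 hi)
      (by rw [Finset.card_image_of_injOn (hinj.mono (by exact_mod_cast hJ1))]; omega)
      (by rw [Finset.card_image_of_injOn (hinj.mono (by
            exact_mod_cast (Finset.sdiff_subset : J \ J1 ⊆ J)))]; omega)
    obtain ⟨i, hi, rfl⟩ := Finset.mem_image.1 hx
    obtain ⟨j, hj, rfl⟩ := Finset.mem_image.1 hy
    rw [Finset.mem_sdiff] at hj
    rcases lt_trichotomy i j with h | h | h
    · exact key i (hJ1 hi) j hj.1 h hxy
    · subst h; exact hj.2 hi
    · exact key j hj.1 i (hJ1 hi) h hxy.symm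
  have hZdeg : ∀ v ∈ Z, 2 * m + 6 ≤ (nbr G {v} ∩ Z).card := by
    intro v hv
    have h1 := hfew v hv
    have h2 := hdeg v (Finset.mem_sdiff.1 hv).1
    have h3 : nbr G {v} ∩ W ⊆ (nbr G {v} ∩ Z) ∪ (nbr G {v} ∩ l.toFinset) := by
      intro x hx
      simp only [hZ, Finset.mem_inter, Finset.mem_union, Finset.mem_sdiff] at hx ⊢
      tauto
    have h4 := Finset.card_le_card h3
    have h5 := Finset.card_union_le (nbr G {v} ∩ Z) (nbr G {v} ∩ l.toFinset)
    omega
  have hv0Z : v0 ∈ Z := by simp [hZ, hv0, hv0l]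
  have hZm : m ≤ Z.card := by
    have h1 := hZdeg v0 hv0Z
    have h2 := Finset.card_le_card (Finset.inter_subset_right : nbr G {v0} ∩ Z ⊆ Z)
    omega
  have hlen2 : 2 ≤ l.length := by
    obtain ⟨_, _, _, c4, c5⟩ := hl
    match l, c4, c5 with
    | [], h, _ => simp at h
    | [x], h, h' => simp at h h'; exact absurd (h.symm.trans h') hab
    | _ :: _ :: _, _, _ => simp
  -- a consecutive pair attached to Z
  have hpair : ∃ i, i + 1 < l.length ∧ (∃ u ∈ Z, G.Adj (g i) u) ∧ ∃ u ∈ Z, G.Adj (g (i + 1)) u := by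
    by_cases hsmall : l.length ≤ 2 * m + 1
    · have hatt : ∀ i, i < l.length → ∃ u ∈ Z, G.Adj (g i) u := by
        intro i hi
        have h1 := hdeg (g i) (hl.2.2.1 _ (hgmem i hi))
        have h2 : ((nbr G {g i} ∩ W) \ l.toFinset).Nonempty := by
          rw [← Finset.card_pos]
          have := Finset.le_card_sdiff l.toFinset (nbr G {g i} ∩ W)
          have := List.toFinset_card_le l
          omega
        obtain ⟨u, hu⟩ := h2
        simp only [Finset.mem_inter, mem_nbr, Finset.mem_singleton, exists_eq_left,
          Finset.mem_sdiff] at hu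
        exact ⟨u, by rw [hZ, Finset.mem_sdiff]; exact ⟨hu.1.2, hu.2⟩, hu.1.1⟩
      exact ⟨0, by omega, hatt 0 (by omega), hatt 1 (by omega)⟩
    · by_contra hno
      push Not at hno
      have hch : ∀ j, ∃ i, j < m → (i / 2 = j ∧ i < l.length ∧ ∀ u ∈ Z, ¬ G.Adj (g i) u) := by
        intro j
        by_cases h : ∃ u ∈ Z, G.Adj (g (2 * j)) u
        · by_cases hj : j < m
          · exact ⟨2 * j + 1, fun _ => ⟨by omega, by omega, hno (2 * j) (by omega) h⟩⟩
          · exact ⟨0, fun h => absurd h hj⟩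
        · push Not at h
          exact ⟨2 * j, fun hj => ⟨by omega, by omega, h⟩⟩
      choose f hf using hch
      obtain ⟨x, hx, y, hy, hxy⟩ := hJ ((Finset.range m).image fun j => g (f j)) Z (by
          rw [Finset.disjoint_left]
          intro x hx hxZ
          obtain ⟨j, hj, rfl⟩ := Finset.mem_image.1 hx
          rw [hZ, Finset.mem_sdiff, List.mem_toFinset] at hxZ
          exact hxZ.2 (hgmem _ (hf j (Finset.mem_range.1 hj)).2.1))
        (by
          rw [Finset.card_image_of_injOn]
          · simp
          · intro i hi j hj hij
            have hi' := hf i (by simpa using hi)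
            have hj' := hf j (by simpa using hj)
            have := hginj _ _ hi'.2.1 hj'.2.1 hij
            rw [← hi'.1, ← hj'.1, this]) hZm
      obtain ⟨j, hj, rfl⟩ := Finset.mem_image.1 hx
      exact (hf j (Finset.mem_range.1 hj)).2.2 y hy hxy
  obtain ⟨i, hi, ⟨u, hu, hiu⟩, u', hu', hiu'⟩ := hpair
  have hP := hl
  rw [← List.take_append_drop (i + 1) l] at hP
  have hlong : ∀ seg : List V, seg ≠ [] → seg.IsChain G.Adj → seg.Nodup → (∀ v ∈ seg, v ∈ Z) →
      seg.head? = some u → seg.getLast? = some u' → False := by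
    intro seg h0 h1 h2 h3 h4 h5
    have hR := hP.insertSeg (htake i (by omega)) (hdrop (i + 1) hi) h1 h2
      (fun v hv => (Finset.mem_sdiff.1 (h3 v hv)).1) (by
        rw [List.take_append_drop]
        intro v hv hvl
        exact (Finset.mem_sdiff.1 (h3 v hv)).2 (List.mem_toFinset.2 hvl)) h4 h5 hiu hiu'.symm
    have h6 := hmax _ hR
    have h7 := congrArg List.length (List.take_append_drop (i + 1) l)
    have h8 := List.length_pos_of_ne_nil h0
    simp only [List.length_append] at h6 h7
    omega
  by_cases huu : u = u'
  · subst huu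
    exact hlong [u] (by simp) (by simp) (by simp) (by simpa using hu) rfl rfl
  · obtain ⟨x, hx, y, hy, hc, hn⟩ := connect4 hJ Z huu (by have := hZdeg u hu; omega)
      (by have := hZdeg u' hu'; omega)
    exact hlong [u, x, y, u'] (by simp) hc hn (by simp [hu, hu', hx, hy]) rfl rfl

end hamilton
section longpath

lemma long_case {V τ : Type*} [Fintype V] [DecidableEq V] [Fintype τ] [DecidableEq τ]
    {G : SimpleGraph V} {m Δ k : ℕ} (hJ : JoinedAt G m) (hm : 1 ≤ m)
    (hcard : Fintype.card τ = Fintype.card V)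
    {par : τ → τ} {root : τ} {rk : τ → ℕ} (hrk : ∀ u, u ≠ root → rk (par u) < rk u)
    (hK : ∀ t, (kids par root Finset.univ t).card ≤ Δ) (w : τ)
    (hnr : ∀ i, i ≤ k → par^[i] w ≠ root)
    (huni : ∀ i, 1 ≤ i → i ≤ k → (kids par root Finset.univ (par^[i] w)).card = 1)
    (hk : 2 * m * (4 * m + 6 + (Δ + 1)) + 2 * m + 2 ≤ k)
    (hexp : ∀ U : Finset V, U.Nonempty → U.card < m →
      (4 * m + 6 + (Δ + 1) + 1) * U.card ≤ (nbr G U).card) :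
    ∃ f : τ → V, Function.Injective f ∧ ∀ u, u ≠ root → G.Adj (f u) (f (par u)) := by
  classical
  set p : ℕ → τ := fun i => par^[i] w with hp
  have hps : ∀ i, p (i + 1) = par (p i) := fun i => Function.iterate_succ_apply' par i w
  have hp0 : p 0 = w := rfl
  have hstep : ∀ i, i ≤ k → rk (p (i + 1)) < rk (p i) := by
    intro i hi; rw [hps]; exact hrk _ (hnr i hi)
  have hdec : ∀ j i, i < j → j ≤ k + 1 → rk (p j) < rk (p i) := by
    intro j
    induction j with
    | zero => intro i hi; omega
    | succ j ih =>
      intro i hi hj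
      have h1 := hstep j (by omega)
      rcases Nat.lt_succ_iff_lt_or_eq.1 hi with h | h
      · exact h1.trans (ih i h (by omega))
      · subst h; exact h1
  have hpinj : ∀ i j, i ≤ k + 1 → j ≤ k + 1 → p i = p j → i = j := by
    intro i j hi hj hij
    rcases lt_trichotomy i j with h | h | h
    · have := hdec j i h hj; rw [hij] at this; omega
    · exact h
    · have := hdec i j h hi; rw [hij] at this; omega
  set Pn : Finset τ := (Finset.Icc 1 k).image p with hPn
  have hPnm : ∀ u, u ∈ Pn ↔ ∃ i, 1 ≤ i ∧ i ≤ k ∧ p i = u := by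
    intro u; simp [hPn, and_assoc]
  have hPnc : Pn.card = k := by
    rw [hPn, Finset.card_image_of_injOn]
    · simp
    · intro i hi j hj hij
      simp at hi hj
      exact hpinj i j (by omega) (by omega) hij
  set I : Finset τ := Finset.univ \ Pn with hI
  have hIm : ∀ u, u ∈ I ↔ u ∉ Pn := by intro u; simp [hI]
  have hIc : I.card + k = Fintype.card V := by
    have h1 := Finset.card_sdiff_add_card_eq_card (Finset.subset_univ Pn)
    rw [Finset.card_univ, hPnc, hcard] at h1
    exact h1
  set a := p (k + 1) with ha
  have hwI : w ∈ I := by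
    rw [hIm, hPnm]; rintro ⟨i, h1, h2, h3⟩
    have := hpinj i 0 (by omega) (by omega) h3; omega
  have haI : a ∈ I := by
    rw [hIm, hPnm]; rintro ⟨i, h1, h2, h3⟩
    have := hpinj i (k + 1) (by omega) (by omega) h3; omega
  have hwr : w ≠ root := hnr 0 (by omega)
  have hwa : w ≠ a := by
    intro h
    have := hpinj 0 (k + 1) (by omega) (by omega) h; omega
  set par' : τ → τ := Function.update par w a with hpar'
  have hrI : root ∈ I := by
    rw [hIm, hPnm]; rintro ⟨i, h1, h2, h3⟩
    exact hnr i h2 h3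
  have hparI : ∀ u ∈ I, u ≠ root → u ≠ w → par u ∈ I := by
    intro u hu hur huw
    rw [hIm, hPnm]; rintro ⟨i, h1, h2, h3⟩
    obtain ⟨z, hz⟩ := Finset.card_eq_one.1 (huni i h1 h2)
    have e1 : u ∈ kids par root Finset.univ (par^[i] w) := by
      simp only [kids, Finset.mem_filter, Finset.mem_univ, true_and]
      exact ⟨hur, h3.symm⟩
    have e2 : p (i - 1) ∈ kids par root Finset.univ (par^[i] w) := by
      simp only [kids, Finset.mem_filter, Finset.mem_univ, true_and]
      refine ⟨hnr _ (by omega), ?_⟩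
      rw [← hps, Nat.sub_add_cancel h1]
    rw [hz, Finset.mem_singleton] at e1 e2
    have e3 : u = p (i - 1) := e1.trans e2.symm
    by_cases hi : i = 1
    · subst hi; exact huw e3
    · exact (hIm u).1 hu ((hPnm u).2 ⟨i - 1, by omega, by omega, e3.symm⟩)
  have hcl : PClosed par' root I := by
    refine ⟨hrI, fun u hu hur => ?_⟩
    by_cases huw : u = w
    · subst huw; simpa [hpar'] using haI
    · rw [hpar', Function.update_of_ne huw]; exact hparI u hu hur huw
  have hK' : ∀ t, (kids par' root I t).card ≤ Δ + 1 := by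
    intro t
    have hsub : kids par' root I t ⊆ insert w (kids par root Finset.univ t) := by
      intro u hu
      simp only [kids, Finset.mem_filter, Finset.mem_univ, true_and, Finset.mem_insert] at hu ⊢
      by_cases huw : u = w
      · exact Or.inl huw
      · rw [hpar', Function.update_of_ne huw] at hu
        exact Or.inr hu.2
    have h1 := Finset.card_le_card hsub
    have h2 := Finset.card_insert_le w (kids par root Finset.univ t)
    have h3 := hK t
    omega
  have hrk' : ∀ u ∈ I, u ≠ root → rk (par' u) < rk u := by
    intro u _ hur
    by_cases huw : u = w
    · subst huw
      simp only [hpar', Function.update_self]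
      exact hdec (k + 1) 0 (by omega) le_rfl
    · rw [hpar', Function.update_of_ne huw]; exact hrk u hur
  obtain ⟨v0⟩ : Nonempty V := by
    rw [← Fintype.card_pos_iff, ← hcard]; exact Fintype.card_pos_iff.2 ⟨w⟩
  have hinit := GoodEmb.init (par := par') (root := root) (I := I) hJ hm hK' hexp (by omega) v0
  obtain ⟨φ, hφ, -⟩ := GoodEmb.growTo hJ hm hrk' hK' hcl subset_rfl (by omega) _ {root} _ rfl
    (by simpa using hrI) hinit
  have hdeg := hφ.deg hm
  obtain ⟨-, hinj, hadj, -⟩ := hφ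
  set R : Finset V := Finset.univ \ I.image φ with hR
  have hRm : ∀ v, v ∈ R ↔ v ∉ I.image φ := by intro v; simp [hR]
  have hRc : R.card = k := by
    have h1 := Finset.card_sdiff_add_card_eq_card (Finset.subset_univ (I.image φ))
    rw [Finset.card_univ, Finset.card_image_of_injOn hinj] at h1
    rw [hR]; omega
  set W : Finset V := insert (φ w) (insert (φ a) R) with hW
  have hφwa : φ w ≠ φ a := fun h => hwa (hinj hwI haI h)
  have hWc : W.card = k + 2 := by
    rw [hW, Finset.card_insert_of_notMem, Finset.card_insert_of_notMem, hRc]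
    · rw [hRm]; simp only [not_not]; exact Finset.mem_image_of_mem _ haI
    · rw [Finset.mem_insert, not_or, hRm, not_not]
      exact ⟨hφwa, Finset.mem_image_of_mem _ hwI⟩
  obtain ⟨l, hl, hlW⟩ := ham_path hJ hm W hφwa (by simp [hW]) (by simp [hW]) (by
    intro v _
    refine (hdeg v).trans (Finset.card_le_card ?_)
    intro x hx
    rw [Finset.mem_sdiff] at hx
    rw [Finset.mem_inter, hW, Finset.mem_insert, Finset.mem_insert, hRm]
    exact ⟨hx.1, Or.inr (Or.inr hx.2)⟩)
  obtain ⟨hlc, hln, hlW', hlh, hlt⟩ := hl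
  have hll : l.length = k + 2 := by
    rw [← List.toFinset_card_of_nodup hln, ← hWc]
    congr 1
    ext v; rw [List.mem_toFinset]; exact ⟨hlW' v, hlW v⟩
  set g : ℕ → V := fun i => l.getD i (φ w) with hg
  have hgi : ∀ i (hi : i < l.length), g i = l[i] := by
    intro i hi; simp [hg, hi]
  have hginj : ∀ i j, i ≤ k + 1 → j ≤ k + 1 → g i = g j → i = j := by
    intro i j hi hj hij
    rw [hgi i (by omega), hgi j (by omega)] at hij
    exact (List.Nodup.getElem_inj_iff hln).1 hij
  have hgadj : ∀ i, i ≤ k → G.Adj (g i) (g (i + 1)) := by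
    intro i hi
    rw [hgi i (by omega), hgi (i + 1) (by omega)]
    exact List.isChain_iff_getElem.1 hlc i (by omega)
  have hg0 : g 0 = φ w := by
    rw [hgi 0 (by omega)]
    rw [List.head?_eq_getElem?, List.getElem?_eq_getElem (by omega)] at hlh
    exact Option.some.inj hlh
  have hgl : g (k + 1) = φ a := by
    rw [hgi (k + 1) (by omega)]
    rw [List.getLast?_eq_getElem?, hll, List.getElem?_eq_getElem (by omega)] at hlt
    exact Option.some.inj hlt
  have hgR : ∀ i, 1 ≤ i → i ≤ k → g i ∉ I.image φ := by
    intro i h1 h2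
    have h3 : g i ∈ W := hlW' _ (by rw [hgi i (by omega)]; exact List.getElem_mem _)
    rw [hW, Finset.mem_insert, Finset.mem_insert, hRm] at h3
    rcases h3 with h | h | h
    · rw [← hg0] at h; have := hginj _ _ (by omega) (by omega) h; omega
    · rw [← hgl] at h; have := hginj _ _ (by omega) (by omega) h; omega
    · exact h
  choose! idx hidx using fun u => (hPnm u).1
  set f : τ → V := fun u => if u ∈ Pn then g (idx u) else φ u with hf
  have hfI : ∀ u ∈ I, f u = φ u := by
    intro u hu; simp only [hf]; rw [if_neg ((hIm u).1 hu)]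
  have hfp : ∀ i, i ≤ k + 1 → f (p i) = g i := by
    intro i hi
    rcases Nat.eq_zero_or_pos i with h | h
    · subst h; rw [hg0]; exact hfI w hwI
    · by_cases hik : i = k + 1
      · subst hik; rw [hgl]; exact hfI a haI
      · have hmem : p i ∈ Pn := (hPnm _).2 ⟨i, h, by omega, rfl⟩
        simp only [hf]
        rw [if_pos hmem]
        have h2 := hidx _ hmem
        rw [hpinj _ _ (by omega) hi h2.2.2]
  have hPI : ∀ u, u ∉ I → ∃ i, 1 ≤ i ∧ i ≤ k ∧ p i = u := by
    intro u hu
    rw [hIm, not_not] at hu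
    exact (hPnm u).1 hu
  refine ⟨f, ?_, ?_⟩
  · have hmix : ∀ u v, u ∈ I → v ∉ I → f u ≠ f v := by
      intro u v hu hv huv
      obtain ⟨i, h1, h2, rfl⟩ := hPI v hv
      rw [hfI u hu, hfp i (by omega)] at huv
      exact hgR i h1 h2 (huv ▸ Finset.mem_image_of_mem _ hu)
    intro u v huv
    by_cases hu : u ∈ I
    · by_cases hv : v ∈ I
      · rw [hfI u hu, hfI v hv] at huv
        exact hinj hu hv huv
      · exact absurd huv (hmix u v hu hv)
    · by_cases hv : v ∈ I
      · exact absurd huv.symm (hmix v u hv hu)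
      · obtain ⟨i, h1, h2, rfl⟩ := hPI u hu
        obtain ⟨j, h3, h4, rfl⟩ := hPI v hv
        rw [hfp i (by omega), hfp j (by omega)] at huv
        rw [hginj i j (by omega) (by omega) huv]
  · intro u hur
    have hchain : ∀ i, i ≤ k → G.Adj (f (p i)) (f (par (p i))) := by
      intro i hi
      rw [← hps, hfp i (by omega), hfp (i + 1) (by omega)]
      exact hgadj i hi
    by_cases huw : u = w
    · subst huw; exact hchain 0 (by omega)
    by_cases hu : u ∈ I
    · rw [hfI u hu, hfI _ (hparI u hu hur huw)]
      have := hadj u hu hur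
      rwa [hpar', Function.update_of_ne huw] at this
    · obtain ⟨i, h1, h2, rfl⟩ := hPI u hu
      exact hchain i h2

end longpath
section leaves

lemma iter_root {τ : Type*} {par : τ → τ} {root : τ} (h0 : par root = root) (i : ℕ) :
    par^[i] root = root := by
  induction i with
  | zero => rfl
  | succ i ih => rw [Function.iterate_succ_apply, h0, ih]

lemma iter_to_root {τ : Type*} {par : τ → τ} {root : τ} {rk : τ → ℕ}
    (hrk : ∀ u, u ≠ root → rk (par u) < rk u) :
    ∀ (r : ℕ) (u : τ), rk u ≤ r → ∃ i, par^[i] u = root := by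
  intro r
  induction r with
  | zero =>
    intro u hu
    by_cases h : u = root
    · exact ⟨0, h⟩
    · have := hrk u h; omega
  | succ r ih =>
    intro u hu
    by_cases h : u = root
    · exact ⟨0, h⟩
    · obtain ⟨i, hi⟩ := ih (par u) (by have := hrk u h; omega)
      exact ⟨i + 1, by rw [Function.iterate_succ_apply]; exact hi⟩

lemma cut_leaves {τ : Type*} [Fintype τ] [DecidableEq τ]
    {par : τ → τ} {root : τ} {rk : τ → ℕ} {Δ k s : ℕ} (h0 : par root = root)
    (hrk : ∀ u, u ≠ root → rk (par u) < rk u)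
    (hK : ∀ t, (kids par root Finset.univ t).card ≤ Δ) (hΔ : 1 ≤ Δ) (hs : 1 ≤ s)
    (hn : Δ * s < Fintype.card τ)
    (hno : ¬ ∃ w, (∀ i, i ≤ k → par^[i] w ≠ root) ∧
      (∀ i, 1 ≤ i → i ≤ k → (kids par root Finset.univ (par^[i] w)).card = 1)) :
    ∃ B : Finset τ, PClosed par root B ∧ B.card + s ≤ Fintype.card τ ∧
      Fintype.card τ ≤ Δ * s + (k + 1) * (2 * (B.filter fun u => u ≠ root ∧
        kids par root Finset.univ u = ∅).card + 5) := by
  classical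
  have hmk : ∀ X u t, u ∈ kids par root X t ↔ u ∈ X ∧ u ≠ root ∧ par u = t := by
    intro X u t; simp [kids]
  set sub : τ → Finset τ := fun v => Finset.univ.filter fun u => ∃ i : ℕ, par^[i] u = v with hsub
  have hsubm : ∀ v u, u ∈ sub v ↔ ∃ i : ℕ, par^[i] u = v := by intro v u; simp [hsub]
  have hroot : sub root = Finset.univ := by
    ext u; simp only [hsubm, Finset.mem_univ, iff_true]
    exact iter_to_root hrk _ u le_rfl
  obtain ⟨v, hv, hvmax⟩ := Finset.exists_max_image
    (Finset.univ.filter fun v => s ≤ (sub v).card) rk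
    ⟨root, by
      rw [Finset.mem_filter, hroot, Finset.card_univ]
      refine ⟨Finset.mem_univ _, ?_⟩
      have := Nat.mul_le_mul_right s hΔ
      omega⟩
  rw [Finset.mem_filter] at hv
  have hkid : ∀ c ∈ kids par root Finset.univ v, (sub c).card ≤ s - 1 := by
    intro c hc
    by_contra hcon
    have h1 := hvmax c (by simp; omega)
    rw [hmk] at hc
    have h2 := hrk c hc.2.1
    rw [hc.2.2] at h2; omega
  have hsubs : sub v ⊆ insert v ((kids par root Finset.univ v).biUnion sub) := by
    intro u hu
    have hex := (hsubm v u).1 hu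
    rw [Finset.mem_insert, Finset.mem_biUnion]
    have hf := Nat.find_spec hex
    have hmin := fun j => Nat.find_min (m := j) hex
    rcases hN : Nat.find hex with _ | j
    · left; rw [hN] at hf; exact hf
    · right
      rw [hN] at hf
      rw [Function.iterate_succ_apply'] at hf
      refine ⟨par^[j] u, ?_, (hsubm _ _).2 ⟨j, rfl⟩⟩
      rw [hmk]
      refine ⟨Finset.mem_univ _, fun hc => ?_, hf⟩
      apply hmin j (by omega)
      rw [hc] at hf ⊢
      rw [← hf, h0]
  have hsubc : (sub v).card ≤ Δ * s := by
    have h1 := Finset.card_le_card hsubs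
    have h2 := Finset.card_insert_le v ((kids par root Finset.univ v).biUnion sub)
    have h3 := Finset.card_biUnion_le_card_mul (kids par root Finset.univ v) sub (s - 1) hkid
    have h4 := Nat.mul_le_mul_right (s - 1) (hK v)
    have h5 : Δ * (s - 1) + Δ = Δ * s := by
      obtain ⟨t, rfl⟩ := Nat.exists_eq_add_of_le hs
      simp; ring
    omega
  have hvr : v ≠ root := by
    rintro rfl
    rw [hroot, Finset.card_univ] at hsubc
    omega
  set B : Finset τ := Finset.univ \ sub v with hB
  have hBm : ∀ u, u ∈ B ↔ u ∉ sub v := by intro u; simp [hB]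
  have hBc : B.card + (sub v).card = Fintype.card τ := by
    rw [hB, Finset.card_sdiff_add_card_eq_card (Finset.subset_univ _), Finset.card_univ]
  have hrB : root ∈ B := by
    rw [hBm, hsubm]; rintro ⟨i, hi⟩
    rw [iter_root h0] at hi; exact hvr hi.symm
  have hBp : ∀ u ∈ B, par u ∈ B := by
    intro u hu
    rw [hBm, hsubm] at *
    rintro ⟨i, hi⟩
    exact hu ⟨i + 1, by rw [Function.iterate_succ_apply]; exact hi⟩
  have hBk : ∀ u ∈ B, u ≠ par v → kids par root Finset.univ u = kids par root B u := by
    intro u hu huv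
    apply subset_antisymm _ (kids_mono (Finset.subset_univ _) _)
    intro x hx
    rw [hmk] at hx ⊢
    refine ⟨?_, hx.2⟩
    rw [hBm, hsubm]
    rintro ⟨i, hi⟩
    rcases i with _ | i
    · apply huv; rw [← hx.2.2]; congr 1
    · rw [Function.iterate_succ_apply, hx.2.2] at hi
      rw [hBm, hsubm] at hu
      exact hu ⟨i, hi⟩
  refine ⟨B, ⟨hrB, fun u hu _ => hBp u hu⟩, by omega, ?_⟩
  set Λ := B.filter fun u => u ≠ root ∧ kids par root Finset.univ u = ∅ with hΛ
  set c : τ → ℕ := fun u => (kids par root B u).card with hc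
  have hsum : ∑ u ∈ B, c u = (B.erase root).card := by
    rw [Finset.card_eq_sum_card_fiberwise (f := par) (t := B)]
    · apply Finset.sum_congr rfl
      intro u _
      simp only [hc]
      congr 1
      ext x; rw [hmk]; simp; tauto
    · intro u hu
      exact hBp u (Finset.mem_of_mem_erase hu)
  rw [Finset.card_erase_of_mem hrB] at hsum
  have hBpos : 1 ≤ B.card := Finset.card_pos.2 ⟨root, hrB⟩
  set N0 := B.filter fun u => c u = 0 with hN0
  set N2 := B.filter fun u => 2 ≤ c u with hN2
  have hN : N2.card ≤ N0.card := by
    have h1 : ∑ u ∈ B, (1 + if 2 ≤ c u then 1 else 0) ≤ ∑ u ∈ B, (c u + if c u = 0 then 1 else 0) := by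
      apply Finset.sum_le_sum
      intro u _
      split_ifs <;> omega
    rw [Finset.sum_add_distrib, Finset.sum_add_distrib, ← Finset.card_filter,
      ← Finset.card_filter, hsum, Finset.sum_const, smul_eq_mul, mul_one] at h1
    rw [hN0, hN2]; omega
  have hN0c : N0.card ≤ Λ.card + 2 := by
    have h1 : N0 ⊆ insert (par v) (insert root Λ) := by
      intro u hu
      rw [hN0, Finset.mem_filter] at hu
      rw [Finset.mem_insert, Finset.mem_insert]
      by_cases h1 : u = par v
      · exact Or.inl h1
      by_cases h2 : u = root
      · exact Or.inr (Or.inl h2)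
      refine Or.inr (Or.inr ?_)
      rw [hΛ, Finset.mem_filter]
      refine ⟨hu.1, h2, ?_⟩
      rw [hBk u hu.1 h1]
      exact Finset.card_eq_zero.1 hu.2
    have h2 := Finset.card_le_card h1
    have h3 := Finset.card_insert_le (par v) (insert root Λ)
    have h4 := Finset.card_insert_le root Λ
    omega
  set NN := insert (par v) (N0 ∪ N2) with hNN
  have hNNc : NN.card ≤ 2 * Λ.card + 5 := by
    have h3 := Finset.card_insert_le (par v) (N0 ∪ N2)
    have h4 := Finset.card_union_le N0 N2
    rw [← hNN] at h3
    omega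
  have hcov : B ⊆ (NN ×ˢ Finset.range (k + 1)).image fun x => par^[x.2] x.1 := by
    intro u hu
    by_contra hcon
    have hcon' : ∀ i, i ≤ k → ∀ x, par^[i] x = u → x ∉ NN := by
      intro i hi x hx hxN
      apply hcon
      rw [Finset.mem_image]
      exact ⟨(x, i), by simp [hxN]; omega, hx⟩
    have key : ∀ i, i ≤ k + 1 → ∃ x ∈ B, par^[i] x = u ∧ (∀ j, j < i → par^[j] x ≠ root) ∧
        (∀ j, 1 ≤ j → j ≤ i → (kids par root Finset.univ (par^[j] x)).card = 1) := by
      intro i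
      induction i with
      | zero =>
        intro _
        exact ⟨u, hu, rfl, fun j hj => by omega, fun j h1 h2 => by omega⟩
      | succ i ih =>
        intro hi
        obtain ⟨x, hxB, hxu, hx1, hx2⟩ := ih (by omega)
        have hxN := hcon' i (by omega) x hxu
        rw [hNN, Finset.mem_insert, Finset.mem_union, hN0, hN2, Finset.mem_filter,
          Finset.mem_filter] at hxN
        push Not at hxN
        have hc1 : c x = 1 := by
          have h1 := hxN.2.1 hxB
          have h2 := hxN.2.2 hxB
          omega
        obtain ⟨y, hy⟩ := Finset.card_eq_one.1 hc1
        have hyk : y ∈ kids par root B x := by rw [hy]; simp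
        rw [hmk] at hyk
        refine ⟨y, hyk.1, ?_, ?_, ?_⟩
        · rw [Function.iterate_succ_apply, hyk.2.2]; exact hxu
        · intro j hj
          rcases j with _ | j
          · exact hyk.2.1
          · rw [Function.iterate_succ_apply, hyk.2.2]; exact hx1 j (by omega)
        · intro j h1 h2
          rcases j with _ | j
          · omega
          · rw [Function.iterate_succ_apply, hyk.2.2]
            rcases Nat.eq_zero_or_pos j with h | h
            · subst h
              rw [Function.iterate_zero, id, hBk x hxB hxN.1]; exact hc1
            · exact hx2 j h (by omega)
    obtain ⟨x, -, -, hx1, hx2⟩ := key (k + 1) le_rfl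
    exact hno ⟨x, fun i hi => hx1 i (by omega), fun i h1 h2 => hx2 i h1 (by omega)⟩
  have h1 := (Finset.card_le_card hcov).trans Finset.card_image_le
  rw [Finset.card_product, Finset.card_range] at h1
  have h2 := Nat.mul_le_mul_right (k + 1) hNNc
  have h3 : (k + 1) * (2 * Λ.card + 5) = (2 * Λ.card + 5) * (k + 1) := mul_comm _ _
  omega

end leaves
section covering

/-- Members of `P` whose parent is not yet embedded. -/
def pfree {τ : Type*} [DecidableEq τ] (par : τ → τ) (root : τ) (P S : Finset τ) : Finset τ :=
  P.filter fun p => p ≠ root ∧ par p ∉ S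

variable {V τ : Type*} [Fintype V] [DecidableEq V] [Fintype τ] [DecidableEq τ]
  {G : SimpleGraph V} {m Δ : ℕ} {par : τ → τ} {root : τ} {rk : τ → ℕ}

lemma cover_step (hJ : JoinedAt G m) (hm : 1 ≤ m)
    (hrk : ∀ u, u ≠ root → rk (par u) < rk u)
    (hK : ∀ t, (kids par root Finset.univ t).card ≤ Δ)
    {A P : Finset τ} (hA : PClosed par root A) (hPA : P ⊆ A)
    {D : ℕ} {S : Finset τ} {φ : τ → V}
    (h : GoodEmb G m par root Finset.univ Δ (D + 2) S φ) (hSA : S ⊆ A) (hD : 2 * m ≤ D)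
    (hsl : A.card + 2 * m * (D + 2 + Δ) + 2 * m ≤ Fintype.card V)
    (hne : (pfree par root P S).Nonempty) (q : V) :
    ∃ S' φ' p, S ⊆ S' ∧ S' ⊆ A ∧ GoodEmb G m par root Finset.univ Δ D S' φ' ∧
      Set.EqOn φ' φ S ∧ p ∈ P ∧ p ∈ S' ∧ p ∉ S ∧ G.Adj q (φ' p) ∧
      (pfree par root P S).card ≤ (pfree par root P S').card + 2 * Δ := by
  have hpm : ∀ S x, x ∈ pfree par root P S ↔ x ∈ P ∧ x ≠ root ∧ par x ∉ S := by
    intro S x; simp [pfree]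
  obtain ⟨p, hp, hmin⟩ := Finset.exists_min_image _ (fun p => rk (par p)) hne
  rw [hpm] at hp
  obtain ⟨hpP, hpr, hps⟩ := hp
  have hcl := h.1
  have hqr : par p ≠ root := by intro hc; rw [hc] at hps; exact hps hcl.1
  have hpar : par p ∈ A := hA.2 p (hPA hpP) hpr
  set Sp := S ∪ A.filter fun u => rk u < rk (par p) with hSp
  have hSpm : ∀ u, u ∈ Sp ↔ u ∈ S ∨ (u ∈ A ∧ rk u < rk (par p)) := by
    intro u; simp [hSp]
  have hSpA : Sp ⊆ A := Finset.union_subset hSA (Finset.filter_subset _ _)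
  have hSpcl : PClosed par root Sp := by
    refine ⟨(hSpm _).2 (Or.inl hcl.1), fun u hu hur => ?_⟩
    rw [hSpm] at hu ⊢
    rcases hu with hu | hu
    · exact Or.inl (hcl.2 u hu hur)
    · exact Or.inr ⟨hA.2 u hu.1 hur, (hrk u hur).trans hu.2⟩
  have hSSp : S ⊆ Sp := Finset.subset_union_left
  have hrp := hrk p hpr
  have hq : par p ∉ Sp := by
    rw [hSpm]; rintro (h | h)
    · exact hps h
    · omega
  have hpS0 : p ∉ S := fun hc => hps (hcl.2 p hc hpr)
  have hpS : p ∉ Sp := by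
    rw [hSpm]; rintro (h | h)
    · exact hpS0 h
    · omega
  have hqq : par (par p) ∈ Sp := by
    rw [hSpm]; exact Or.inr ⟨hA.2 _ hpar hqr, hrk _ hqr⟩
  have hpq : p ≠ par p := by intro hc; rw [← hc] at hrp; omega
  have hSpc := Finset.card_le_card hSpA
  obtain ⟨φ1, h1, he1⟩ := GoodEmb.growTo hJ hm (fun u _ hu => hrk u hu) hK hSpcl
    (Finset.subset_univ _) (by omega) _ S φ rfl hSSp h
  obtain ⟨φ2, h2, he2, hadj⟩ := h1.cover hJ hm hK hD hpr hpS hq hqr hqq hpq q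
  refine ⟨insert p (insert (par p) Sp), φ2, p, ?_, ?_, h2, ?_, hpP, by simp, hpS0, hadj, ?_⟩
  · exact hSSp.trans ((Finset.subset_insert _ _).trans (Finset.subset_insert _ _))
  · exact Finset.insert_subset (hPA hpP) (Finset.insert_subset hpar hSpA)
  · intro t ht
    rw [he2 (hSSp ht), he1 ht]
  · have hsub : pfree par root P S ⊆ pfree par root P (insert p (insert (par p) Sp)) ∪
        (kids par root Finset.univ p ∪ kids par root Finset.univ (par p)) := by
      intro x hx
      have hx' := (hpm S x).1 hx
      rw [Finset.mem_union, Finset.mem_union, hpm]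
      by_cases hc : par x ∈ insert p (insert (par p) Sp)
      · right
        rw [Finset.mem_insert, Finset.mem_insert, hSpm] at hc
        rcases hc with hc | hc | hc | hc
        · left; simp [kids, hc, hx'.2.1]
        · right; simp [kids, hc, hx'.2.1]
        · exact absurd hc hx'.2.2
        · have := hmin x hx; omega
      · exact Or.inl ⟨hx'.1, hx'.2.1, hc⟩
    have e1 := Finset.card_le_card hsub
    have e2 := Finset.card_union_le (pfree par root P (insert p (insert (par p) Sp)))
      (kids par root Finset.univ p ∪ kids par root Finset.univ (par p))
    have e3 := Finset.card_union_le (kids par root Finset.univ p)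
      (kids par root Finset.univ (par p))
    have e4 := hK p
    have e5 := hK (par p)
    omega

lemma cover_iter (hJ : JoinedAt G m) (hm : 1 ≤ m)
    (hrk : ∀ u, u ≠ root → rk (par u) < rk u)
    (hK : ∀ t, (kids par root Finset.univ t).card ≤ Δ)
    {A P : Finset τ} (hA : PClosed par root A) (hPA : P ⊆ A)
    {D : ℕ} (hD : 2 * m ≤ D) (Q : Finset V) :
    ∀ (S : Finset τ) (φ : τ → V),
    GoodEmb G m par root Finset.univ Δ (D + 2 * Q.card) S φ → S ⊆ A →
    A.card + 2 * m * (D + 2 * Q.card + Δ) + 2 * m ≤ Fintype.card V →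
    2 * Δ * Q.card < (pfree par root P S).card →
    ∃ S' φ', ∃ c : V → τ, S ⊆ S' ∧ S' ⊆ A ∧ GoodEmb G m par root Finset.univ Δ D S' φ' ∧
      Set.EqOn φ' φ S ∧ Set.InjOn c Q ∧
      (∀ q ∈ Q, c q ∈ P ∧ c q ∈ S' ∧ c q ∉ S ∧ G.Adj q (φ' (c q))) ∧
      (pfree par root P S).card ≤ (pfree par root P S').card + 2 * Δ * Q.card := by
  induction Q using Finset.induction_on with
  | empty =>
    intro S φ h hSA hsl hp
    exact ⟨S, φ, fun _ => root, subset_rfl, hSA, by simpa using h, fun _ _ => rfl, by simp,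
      by simp, by simp⟩
  | insert a Q ha ih =>
    intro S φ h hSA hsl hp
    rw [Finset.card_insert_of_notMem ha] at h hsl hp ⊢
    have hpos : 2 * Δ * (Q.card + 1) = 2 * Δ * Q.card + 2 * Δ := by ring
    have hD' : D + 2 * (Q.card + 1) = D + 2 * Q.card + 2 := by ring
    rw [hD'] at h hsl
    obtain ⟨S1, φ1, p, hS1, hS1A, hg1, he1, hpP, hpS1, hpS, hadj, hc1⟩ :=
      cover_step hJ hm hrk hK hA hPA h hSA (by omega) hsl
        (Finset.card_pos.1 (by omega)) a
    have hsl' : 2 * m * (D + 2 * Q.card + Δ) ≤ 2 * m * (D + 2 * Q.card + 2 + Δ) :=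
      Nat.mul_le_mul_left _ (by omega)
    obtain ⟨S2, φ2, c, hS2, hS2A, hg2, he2, hcinj, hc, hc2⟩ :=
      ih S1 φ1 hg1 hS1A (by omega) (by omega)
    have hne : ∀ q ∈ Q, q ≠ a := by rintro q hq rfl; exact ha hq
    have heq : Set.EqOn (Function.update c a p) c Q := by
      intro q hq; simp [hne q hq]
    refine ⟨S2, φ2, Function.update c a p, hS1.trans hS2, hS2A, hg2, ?_, ?_, ?_, by omega⟩
    · intro t ht
      rw [he2 (hS1 ht), he1 ht]
    · rw [Finset.coe_insert, Set.injOn_insert (by exact_mod_cast ha)]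
      refine ⟨heq.injOn_iff.2 hcinj, ?_⟩
      rintro ⟨q, hq, hqa⟩
      rw [heq hq, Function.update_self] at hqa
      exact (hc q hq).2.2.1 (hqa ▸ hpS1)
    · intro q hq
      rcases Finset.mem_insert.1 hq with rfl | hq
      · rw [Function.update_self]
        exact ⟨hpP, hS2 hpS1, hpS, by rw [he2 hpS1]; exact hadj⟩
      · rw [heq hq]
        obtain ⟨h1, h2, h3, h4⟩ := hc q hq
        exact ⟨h1, h2, fun hh => h3 (hS1 hh), h4⟩

end covering
section leafcase

lemma exists_defect {V : Type*} [Fintype V] [DecidableEq V] {G : SimpleGraph V} {m : ℕ}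
    (hJ : JoinedAt G m) (hm : 1 ≤ m) (W : Finset V) (hW : 4 * m ≤ W.card) :
    ∃ Q1 : Finset V, Q1.card < m ∧ ∀ Q' : Finset V, Disjoint Q1 Q' → Q'.card < m →
      Q'.card ≤ (nbr G Q' ∩ W).card := by
  classical
  obtain ⟨Q1, hQ1, hmax⟩ := Finset.exists_max_image
    ((Finset.univ : Finset (Finset V)).filter fun Q => Q.card < m ∧ (nbr G Q ∩ W).card ≤ Q.card)
    Finset.card ⟨∅, by
      simp only [Finset.mem_filter, Finset.mem_univ, true_and, Finset.card_empty]
      refine ⟨by omega, ?_⟩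
      have : nbr G (∅ : Finset V) = ∅ := by ext v; simp [mem_nbr]
      simp [this]⟩
  simp only [Finset.mem_filter, Finset.mem_univ, true_and] at hQ1 hmax
  refine ⟨Q1, hQ1.1, fun Q' hd hQ' => ?_⟩
  by_contra hcon
  push Not at hcon
  have hc : (Q1 ∪ Q').card = Q1.card + Q'.card := Finset.card_union_of_disjoint hd
  have hn : (nbr G (Q1 ∪ Q') ∩ W).card ≤ (Q1 ∪ Q').card := by
    rw [nbr_union, Finset.union_inter_distrib_right]
    have := Finset.card_union_le (nbr G Q1 ∩ W) (nbr G Q' ∩ W)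
    omega
  by_cases hlt : (Q1 ∪ Q').card < m
  · have := hmax (Q1 ∪ Q') ⟨hlt, hn⟩
    omega
  · obtain ⟨X, hX, hXc⟩ := Finset.exists_subset_card_eq (not_lt.1 hlt)
    have h1 : m ≤ ((W \ (nbr G (Q1 ∪ Q') ∩ W)) \ X).card := by
      have e1 := Finset.le_card_sdiff X (W \ (nbr G (Q1 ∪ Q') ∩ W))
      have e2 := Finset.le_card_sdiff (nbr G (Q1 ∪ Q') ∩ W) W
      omega
    obtain ⟨x, hx, y, hy, hxy⟩ := hJ X _ Finset.disjoint_sdiff hXc.ge h1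
    simp only [Finset.mem_sdiff, Finset.mem_inter, not_and] at hy
    exact hy.1.2 (mem_nbr.2 ⟨x, hX hx, hxy⟩) hy.1.1

variable {V τ : Type*} [Fintype V] [DecidableEq V] [Fintype τ] [DecidableEq τ]
  {G : SimpleGraph V} {m Δ : ℕ} {par : τ → τ} {root : τ} {rk : τ → ℕ}

lemma hall_finish (hJ : JoinedAt G m) (hm : 1 ≤ m)
    (hcard : Fintype.card τ = Fintype.card V)
    {Λ P1 : Finset τ} {φ : τ → V} {Q1 : Finset V} {c : V → τ}
    (hΛr : ∀ u ∈ Λ, u ≠ root) (hΛp : ∀ u, u ≠ root → par u ∉ Λ)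
    (h : GoodEmb G m par root Finset.univ Δ 0 (Finset.univ \ Λ) φ)
    (hP1 : P1 ⊆ Λ.image par)
    (hQ1 : ∀ Q' : Finset V, Disjoint Q1 Q' → Q'.card < m →
      Q'.card ≤ (nbr G Q' ∩ P1.image φ).card)
    (hcinj : Set.InjOn c Q1)
    (hc : ∀ q ∈ Q1, c q ∈ Λ.image par ∧ c q ∉ P1 ∧ G.Adj q (φ (c q))) :
    ∃ f : τ → V, Function.Injective f ∧ ∀ u, u ≠ root → G.Adj (f u) (f (par u)) := by
  classical
  obtain ⟨hcl, hinj, hadj, w, hw1, hw2, hw3, hI⟩ := h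
  set T := Finset.univ \ Λ with hT
  have hTm : ∀ u, u ∈ T ↔ u ∉ Λ := by intro u; simp [hT]
  set im := T.image φ with him
  have hΛc : T.card + Λ.card = Fintype.card V := by
    rw [hT, Finset.card_sdiff_add_card_eq_card (Finset.subset_univ _), Finset.card_univ, hcard]
  have himc : im.card = T.card := Finset.card_image_of_injOn hinj
  have hpT : ∀ u ∈ Λ, par u ∈ T := fun u hu => (hTm _).2 (hΛp u (hΛr u hu))
  have key : ∀ s ⊆ Λ, s.card ≤ (nbr G (s.image fun l => φ (par l)) \ im).card := by
    intro s hs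
    set U := s.image fun l => φ (par l) with hU
    by_cases hU0 : U.Nonempty
    swap
    · have : s = ∅ := by
        rw [Finset.not_nonempty_iff_eq_empty] at hU0
        exact Finset.image_eq_empty.1 hU0
      simp [this]
    by_cases hU2 : U.card ≤ 2 * m
    · refine le_trans ?_ (hI U hU0 hU2)
      rw [Finset.card_eq_sum_card_image (fun l => φ (par l)) s]
      apply Finset.sum_le_sum
      intro u hu
      obtain ⟨l, hl, rfl⟩ := Finset.mem_image.1 hu
      have h1 := hw3 _ (hpT l (hs hl))
      refine le_trans (Finset.card_le_card ?_) (le_trans (Nat.le_add_left _ _) h1)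
      intro x hx
      rw [Finset.mem_filter] at hx
      simp only [kids, Finset.mem_filter, Finset.mem_sdiff, Finset.mem_univ, true_and, hTm,
        not_not]
      exact ⟨hs hx.1, hΛr x (hs hx.1), hinj (hpT x (hs hx.1)) (hpT l (hs hl)) hx.2⟩
    · push Not at hU2
      set Q := (Finset.univ \ im) \ nbr G U with hQ
      have hQm : ∀ q, q ∈ Q ↔ q ∉ im ∧ q ∉ nbr G U := by intro q; simp [hQ]
      have hUim : U ⊆ im := by
        intro x hx
        obtain ⟨l, hl, rfl⟩ := Finset.mem_image.1 hx
        exact Finset.mem_image_of_mem _ (hpT l (hs hl))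
      have hQc : Q.card < m := by
        by_contra hcon
        obtain ⟨x, hx, y, hy, hxy⟩ := hJ U Q (by
          rw [Finset.disjoint_left]; intro x hx hxQ
          exact ((hQm x).1 hxQ).1 (hUim hx)) (by omega) (by omega)
        exact ((hQm y).1 hy).2 (mem_nbr.2 ⟨x, hx, hxy⟩)
      have hbad : ∀ p, ∀ q ∈ Q, G.Adj q (φ p) → p ∉ s.image par := by
        intro p q hq hqp hp
        obtain ⟨l, hl, rfl⟩ := Finset.mem_image.1 hp
        exact ((hQm q).1 hq).2 (mem_nbr.2 ⟨φ (par l), Finset.mem_image.2 ⟨l, hl, rfl⟩, hqp.symm⟩)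
      set C1 := (Q ∩ Q1).image c with hC1
      set C2 := P1.filter fun p => φ p ∈ nbr G (Q \ Q1) with hC2
      have hC1c : C1.card = (Q ∩ Q1).card := Finset.card_image_of_injOn
        (hcinj.mono (by exact_mod_cast Finset.inter_subset_right))
      have hC2c : (Q \ Q1).card ≤ C2.card := by
        have e1 := hQ1 (Q \ Q1) Finset.disjoint_sdiff
          ((Finset.card_le_card Finset.sdiff_subset).trans_lt hQc)
        refine e1.trans ((Finset.card_le_card ?_).trans (Finset.card_image_le (f := φ) (s := C2)))
        intro y hy
        rw [Finset.mem_inter, Finset.mem_image] at hy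
        obtain ⟨hy1, p, hp, rfl⟩ := hy
        exact Finset.mem_image_of_mem _ (Finset.mem_filter.2 ⟨hp, hy1⟩)
      have hC12 : Disjoint C1 C2 := by
        rw [Finset.disjoint_left]
        intro x hx1 hx2
        obtain ⟨q, hq, rfl⟩ := Finset.mem_image.1 hx1
        exact (hc q (Finset.mem_inter.1 hq).2).2.1 (Finset.mem_filter.1 hx2).1
      have hCsub : C1 ∪ C2 ⊆ (Λ \ s).image par := by
        intro p hp
        have h2 : p ∈ Λ.image par ∧ p ∉ s.image par := by
          rcases Finset.mem_union.1 hp with hp | hp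
          · obtain ⟨q, hq, rfl⟩ := Finset.mem_image.1 hp
            rw [Finset.mem_inter] at hq
            have := hc q hq.2
            exact ⟨this.1, hbad _ q hq.1 this.2.2⟩
          · rw [hC2, Finset.mem_filter, mem_nbr] at hp
            obtain ⟨hp1, q, hq, hqp⟩ := hp
            exact ⟨hP1 hp1, hbad _ q (Finset.mem_sdiff.1 hq).1 hqp⟩
        obtain ⟨l, hl, rfl⟩ := Finset.mem_image.1 h2.1
        refine Finset.mem_image_of_mem _ (Finset.mem_sdiff.2 ⟨hl, fun hls => ?_⟩)
        exact h2.2 (Finset.mem_image_of_mem _ hls)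
      have e1 := (Finset.card_le_card hCsub).trans Finset.card_image_le
      rw [Finset.card_union_of_disjoint hC12] at e1
      have e2 := Finset.card_inter_add_card_sdiff Q Q1
      have e3 := Finset.card_sdiff_add_card_eq_card hs
      have e4 : (Finset.univ \ im).card + im.card = Fintype.card V := by
        rw [Finset.card_sdiff_add_card_eq_card (Finset.subset_univ _), Finset.card_univ]
      have e5 : (Finset.univ \ im).card ≤ Q.card + (nbr G U \ im).card := by
        refine le_trans (Finset.card_le_card ?_) (Finset.card_union_le _ _)
        intro x hx
        rw [Finset.mem_union, hQm, Finset.mem_sdiff]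
        rw [Finset.mem_sdiff] at hx
        tauto
      omega
  obtain ⟨g, hginj, hg⟩ := (Finset.all_card_le_biUnion_card_iff_exists_injective
    (fun l : {x // x ∈ Λ} => nbr G {φ (par l.1)} \ im)).1 (by
      intro s
      have h1 := key (s.map (Function.Embedding.subtype _)) (by
        intro x hx
        rw [Finset.mem_map] at hx
        obtain ⟨y, -, rfl⟩ := hx
        exact y.2)
      rw [Finset.card_map] at h1
      refine h1.trans (Finset.card_le_card ?_)
      intro y hy
      rw [Finset.mem_sdiff, mem_nbr] at hy
      obtain ⟨⟨x, hx, hxy⟩, hyi⟩ := hy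
      obtain ⟨l, hl, rfl⟩ := Finset.mem_image.1 hx
      obtain ⟨l', hl', rfl⟩ := Finset.mem_map.1 hl
      rw [Finset.mem_biUnion]
      refine ⟨l', hl', ?_⟩
      rw [Finset.mem_sdiff, mem_nbr]
      exact ⟨⟨_, by simp, hxy⟩, hyi⟩)
  have hg' : ∀ l, G.Adj (φ (par l.1)) (g l) ∧ g l ∉ im := by
    intro l
    have := hg l
    rw [Finset.mem_sdiff, mem_nbr] at this
    simpa using this
  refine ⟨fun u => if hu : u ∈ Λ then g ⟨u, hu⟩ else φ u, ?_, ?_⟩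
  · intro u v huv
    by_cases hu : u ∈ Λ <;> by_cases hv : v ∈ Λ
    · simp only [hu, hv, dif_pos] at huv
      have := hginj huv
      simpa using this
    · simp only [hu, hv, dif_pos, dif_neg, not_false_iff] at huv
      exact absurd (huv ▸ Finset.mem_image_of_mem φ ((hTm v).2 hv)) (hg' ⟨u, hu⟩).2
    · simp only [hu, hv, dif_pos, dif_neg, not_false_iff] at huv
      exact absurd (huv ▸ Finset.mem_image_of_mem φ ((hTm u).2 hu)) (hg' ⟨v, hv⟩).2
    · simp only [hu, hv, dif_neg, not_false_iff] at huv
      exact hinj ((hTm u).2 hu) ((hTm v).2 hv) huv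
  · intro u hur
    have hp := hΛp u hur
    by_cases hu : u ∈ Λ
    · simp only [hu, hp, dif_pos, dif_neg, not_false_iff]
      exact (hg' ⟨u, hu⟩).1.symm
    · simp only [hu, hp, dif_neg, not_false_iff]
      exact hadj u ((hTm u).2 hu) hur

lemma leaf_case {k s : ℕ} (hJ : JoinedAt G m) (hm : 1 ≤ m) (hΔ : 1 ≤ Δ)
    (hcard : Fintype.card τ = Fintype.card V) (h0 : par root = root)
    (hrk : ∀ u, u ≠ root → rk (par u) < rk u)
    (hK : ∀ t, (kids par root Finset.univ t).card ≤ Δ)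
    (hno : ¬ ∃ w, (∀ i, i ≤ k → par^[i] w ≠ root) ∧
      (∀ i, 1 ≤ i → i ≤ k → (kids par root Finset.univ (par^[i] w)).card = 1))
    (hs : 2 * m * (12 * m + Δ) + 2 * m ≤ s)
    (hn : Δ * s + (k + 1) * (2 * (20 * m * Δ ^ 2) + 5) ≤ Fintype.card τ)
    (hexp : ∀ U : Finset V, U.Nonempty → U.card < m →
      (12 * m + Δ + 1) * U.card ≤ (nbr G U).card) :
    ∃ f : τ → V, Function.Injective f ∧ ∀ u, u ≠ root → G.Adj (f u) (f (par u)) := by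
  classical
  obtain ⟨B, hB, hBs, hBn⟩ := cut_leaves (k := k) h0 hrk hK hΔ (s := s) (by omega)
    (by
      have : 0 < (k + 1) * (2 * (20 * m * Δ ^ 2) + 5) := by positivity
      omega) hno
  set Λ := B.filter fun u => u ≠ root ∧ kids par root Finset.univ u = ∅ with hΛ
  have hΛm : ∀ u, u ∈ Λ ↔ u ∈ B ∧ u ≠ root ∧ kids par root Finset.univ u = ∅ := by
    intro u; simp [hΛ]
  have hΛc : 20 * m * Δ ^ 2 ≤ Λ.card := by
    by_contra hcon
    have h1 : (k + 1) * (2 * Λ.card + 5) < (k + 1) * (2 * (20 * m * Δ ^ 2) + 5) :=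
      Nat.mul_lt_mul_of_pos_left (by omega) (by omega)
    omega
  have hΛr : ∀ u ∈ Λ, u ≠ root := fun u hu => ((hΛm u).1 hu).2.1
  have hΛp : ∀ u, u ≠ root → par u ∉ Λ := by
    intro u hu hc
    have h1 := ((hΛm _).1 hc).2.2
    have : u ∈ kids par root Finset.univ (par u) := by simp [kids, hu]
    rw [h1] at this
    simp at this
  set P := Λ.image par with hP
  set A := B \ Λ with hA
  have hAm : ∀ u, u ∈ A ↔ u ∈ B ∧ u ∉ Λ := by intro u; simp [hA]
  have hAcl : PClosed par root A := by
    refine ⟨(hAm _).2 ⟨hB.1, fun h => hΛr _ h rfl⟩, fun u hu hur => ?_⟩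
    rw [hAm] at hu ⊢
    exact ⟨hB.2 u hu.1 hur, hΛp u hur⟩
  have hTcl : PClosed par root (Finset.univ \ Λ) := by
    refine ⟨by simpa using fun h => hΛr _ h rfl, fun u _ hur => ?_⟩
    simpa using hΛp u hur
  have hPA : P ⊆ A := by
    intro p hp
    obtain ⟨u, hu, rfl⟩ := Finset.mem_image.1 hp
    have hur := hΛr u hu
    exact (hAm _).2 ⟨hB.2 u ((hΛm u).1 hu).1 hur, hΛp u hur⟩
  have hPc : 20 * m * Δ ≤ P.card := by
    have h1 := Finset.card_le_mul_card_image (f := par) Λ Δ (by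
      intro t _
      refine (Finset.card_le_card ?_).trans (hK t)
      intro x hx
      rw [Finset.mem_filter] at hx
      simp [kids, hx.2, hΛr x hx.1])
    have h2 : Δ * (20 * m * Δ) ≤ Δ * P.card := by
      refine le_trans (le_of_eq (by ring)) (hΛc.trans h1)
    exact Nat.le_of_mul_le_mul_left h2 hΔ
  have hmΔ : Δ ≤ m * Δ := Nat.le_mul_of_pos_left _ hm
  have hAc : A.card ≤ B.card := Finset.card_le_card Finset.sdiff_subset
  have hpf : P.card ≤ (pfree par root P {root}).card + Δ + 1 := by
    have hsub : P ⊆ pfree par root P {root} ∪ insert root (kids par root Finset.univ root) := by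
      intro p hp
      simp only [pfree, kids, Finset.mem_union, Finset.mem_filter, Finset.mem_insert,
        Finset.mem_univ, true_and, Finset.mem_singleton]
      tauto
    have h1 := (Finset.card_le_card hsub).trans (Finset.card_union_le _ _)
    have h2 := Finset.card_insert_le root (kids par root Finset.univ root)
    have h3 := hK root
    omega
  have hcV : 2 * m * (12 * m + Δ) + 2 * m + B.card ≤ Fintype.card V := by omega
  have hmm : 12 * m ≤ 2 * m * (12 * m + Δ) := by nlinarith
  obtain ⟨v0⟩ : Nonempty V := by
    rw [← Fintype.card_pos_iff]; omega
  have hinit := GoodEmb.init (par := par) (root := root) (I := Finset.univ) hJ hm hK hexp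
    (by omega) v0
  obtain ⟨Q0, -, hQ0⟩ := Finset.exists_subset_card_eq (s := (Finset.univ : Finset V)) (n := 4 * m)
    (by rw [Finset.card_univ]; omega)
  have hD0 : 12 * m = 4 * m + 2 * Q0.card := by omega
  have e1 : 2 * Δ * (4 * m) = 8 * (m * Δ) := by ring
  have e2 : 20 * m * Δ = 20 * (m * Δ) := by ring
  obtain ⟨S1, φ1, c1, -, hS1A, hg1, -, hc1inj, hc1, hpf1⟩ := cover_iter (P := P) (D := 4 * m)
    hJ hm hrk hK hAcl hPA (by omega) Q0 {root} (fun _ => v0) (by rw [← hD0]; exact hinit)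
    (by simpa using hAcl.1) (by rw [← hD0]; omega) (by rw [hQ0]; omega)
  rw [hQ0] at hpf1
  have hinj1 := hg1.2.1
  have hW : 4 * m ≤ ((P ∩ S1).image φ1).card := by
    rw [Finset.card_image_of_injOn (hinj1.mono (by exact_mod_cast Finset.inter_subset_right)),
      ← hQ0]
    apply Finset.card_le_card_of_injOn c1 _ hc1inj
    intro q hq
    have := hc1 q hq
    simp [this.1, this.2.1]
  obtain ⟨Q1, hQ1m, hQ1⟩ := exists_defect hJ hm _ hW
  have e3 : 2 * Δ * Q1.card ≤ 2 * Δ * m := Nat.mul_le_mul_left _ hQ1m.le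
  have e4 : 2 * Δ * m = 2 * (m * Δ) := by ring
  have e5 : 2 * m * (2 * m + 2 * Q1.card + Δ) ≤ 2 * m * (12 * m + Δ) :=
    Nat.mul_le_mul_left _ (by omega)
  obtain ⟨S2, φ2, c, hS12, hS2A, hg2, he2, hcinj, hc, -⟩ := cover_iter (P := P) (D := 2 * m)
    hJ hm hrk hK hAcl hPA le_rfl Q1 S1 φ1 (hg1.drop (by omega)) hS1A (by omega) (by omega)
  have hTc : (Finset.univ \ Λ).card + Λ.card = Fintype.card V := by
    rw [Finset.card_sdiff_add_card_eq_card (Finset.subset_univ _), Finset.card_univ, hcard]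
  have e6 : 2 * m * (0 + Δ) + 2 * m ≤ 20 * m * Δ ^ 2 := by
    have : m * 1 ≤ m * Δ := Nat.mul_le_mul_left _ hΔ
    have : m * Δ * 1 ≤ m * Δ * Δ := Nat.mul_le_mul_left _ hΔ
    nlinarith
  obtain ⟨φ3, hg3, he3⟩ := GoodEmb.growTo hJ hm (fun u _ hu => hrk u hu) hK hTcl
    (Finset.subset_univ _) (by omega) _ S2 φ2 rfl (by
      intro x hx
      have := (hAm x).1 (hS2A hx)
      simpa using this.2) (hg2.drop (Nat.zero_le _))
  have himg : (P ∩ S1).image φ3 = (P ∩ S1).image φ1 := by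
    apply Finset.image_congr
    intro x hx
    have hx1 : x ∈ S1 := (Finset.mem_inter.1 hx).2
    rw [he3 (hS12 hx1), he2 hx1]
  refine hall_finish hJ hm hcard hΛr hΛp hg3 (P1 := P ∩ S1) Finset.inter_subset_left
    (Q1 := Q1) (c := c) (by rw [himg]; exact hQ1) hcinj ?_
  intro q hq
  obtain ⟨h1, h2, h3, h4⟩ := hc q hq
  refine ⟨h1, fun hh => h3 (Finset.mem_inter.1 hh).2, ?_⟩
  rw [he3 h2]; exact h4

end leafcase
lemma numeric_bound {X : ℝ} {n m Δ : ℕ} (hX : X ^ 3 = n) (hX1 : 7 * m * Δ ≤ X)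
    (hX2 : 1000 * Δ ≤ X) (hm : 1 ≤ m) (hΔ : 19 ≤ Δ) :
    Δ * (2 * m * (12 * m + Δ) + 2 * m) + (2 * m * (4 * m + 6 + (Δ + 1)) + 2 * m + 2 + 1) *
      (2 * (20 * m * Δ ^ 2) + 5) ≤ n := by
  have hm' : (1 : ℝ) ≤ m := by exact_mod_cast hm
  have hΔ' : (19 : ℝ) ≤ Δ := by exact_mod_cast hΔ
  rw [← Nat.cast_le (α := ℝ), ← hX]
  push_cast
  set a : ℝ := (m : ℝ)
  set d : ℝ := (Δ : ℝ)
  have had : 1 ≤ a * d := by nlinarith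
  have hX0 : 0 ≤ X := by nlinarith
  have hsq : (7 * a * d) ^ 2 ≤ X ^ 2 := by
    apply pow_le_pow_left₀ (by positivity) hX1
  have h1 : 343 * a ^ 3 * d ^ 3 ≤ X ^ 3 := by
    have : (7 * a * d) ^ 3 ≤ X ^ 3 := pow_le_pow_left₀ (by positivity) hX1 3
    nlinarith
  have h2 : 49000 * a ^ 2 * d ^ 3 ≤ X ^ 3 := by
    have : (7 * a * d) ^ 2 * (1000 * d) ≤ X ^ 2 * X :=
      mul_le_mul hsq hX2 (by positivity) (by positivity)
    nlinarith
  have h3 : 2 * a * (4 * a + 6 + (d + 1)) + 2 * a + 2 + 1 ≤ 8 * a ^ 2 + 3 * (a * d) := by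
    nlinarith
  have h4 : 2 * (20 * a * d ^ 2) + 5 ≤ 41 * (a * d ^ 2) := by
    have : 19 * 19 ≤ d ^ 2 := by nlinarith
    nlinarith
  have h5 : (2 * a * (4 * a + 6 + (d + 1)) + 2 * a + 2 + 1) * (2 * (20 * a * d ^ 2) + 5) ≤
      (8 * a ^ 2 + 3 * (a * d)) * (41 * (a * d ^ 2)) :=
    mul_le_mul h3 h4 (by positivity) (by positivity)
  have h6 : (8 * a ^ 2 + 3 * (a * d)) * (41 * (a * d ^ 2)) =
      328 * (a ^ 3 * d ^ 2) + 123 * (a ^ 2 * d ^ 3) := by ring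
  have h7 : d * (2 * a * (12 * a + d) + 2 * a) = 24 * (a ^ 2 * d) + 2 * (a * d ^ 2) + 2 * (a * d) := by
    ring
  have h8 : 19 * (a ^ 3 * d ^ 2) ≤ a ^ 3 * d ^ 3 := by
    have : 0 ≤ a ^ 3 * d ^ 2 := by positivity
    nlinarith
  have h9 : a * d ≤ a ^ 2 * d ^ 3 := by
    have e1 : 1 * 1 ≤ (a * d) * d := mul_le_mul had (by linarith) (by norm_num) (by positivity)
    have : (a * d) * 1 ≤ (a * d) * ((a * d) * d) := mul_le_mul_of_nonneg_left (by linarith) (by positivity)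
    nlinarith
  have h10 : a * d ^ 2 ≤ a ^ 2 * d ^ 3 := by
    have : (a * d ^ 2) * 1 ≤ (a * d ^ 2) * (a * d) := mul_le_mul_of_nonneg_left had (by positivity)
    nlinarith
  have h11 : a ^ 2 * d ≤ a ^ 2 * d ^ 3 := by
    have : (a ^ 2 * d) * 1 ≤ (a ^ 2 * d) * (d ^ 2) :=
      mul_le_mul_of_nonneg_left (by nlinarith) (by positivity)
    nlinarith
  rw [h7]
  nlinarith

theorem stmt_15 :
    ∃ c : ℝ, 0 < c ∧ ∀ (n Δ : ℕ), Real.log n ≤ (Δ : ℝ) →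
      (Δ : ℝ) ≤ c * (n : ℝ) ^ ((1 : ℝ) / 3) →
      ∀ G : SimpleGraph (Fin n),
        (∀ X : Set (Fin n), 1 ≤ X.ncard →
          (X.ncard : ℝ) < (n : ℝ) ^ ((1 : ℝ) / 3) / (14 * Δ) →
          7 * (Δ : ℝ) * (n : ℝ) ^ ((2 : ℝ) / 3) * X.ncard ≤
            ({v : Fin n | ∃ x ∈ X, G.Adj v x}.ncard : ℝ)) →
        (∀ X Y : Set (Fin n), Disjoint X Y →
          X.ncard = ⌈(n : ℝ) ^ ((1 : ℝ) / 3) / (14 * Δ)⌉₊ →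
          Y.ncard = ⌈(n : ℝ) ^ ((1 : ℝ) / 3) / (14 * Δ)⌉₊ →
          ∃ x ∈ X, ∃ y ∈ Y, G.Adj x y) →
        ∀ T : SimpleGraph (Fin n), T.IsTree → maxDeg T ≤ Δ → ContainsCopy T G := by
  classical
  refine ⟨Real.exp (-10), Real.exp_pos _, ?_⟩
  intro n Δ hlog hΔX G hexp0 hjoin0 T hT hdeg
  rcases Nat.lt_or_ge n 2 with hn | hn
  · refine ⟨id, Function.injective_id, fun u v huv => ?_⟩
    exfalso
    apply huv.ne
    apply Fin.ext
    have := u.2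
    have := v.2
    omega
  set X : ℝ := (n : ℝ) ^ ((1 : ℝ) / 3) with hX
  have hn0 : (0 : ℝ) ≤ n := Nat.cast_nonneg n
  have hn2 : (2 : ℝ) ≤ n := by exact_mod_cast hn
  have hX3 : X ^ 3 = n := by
    rw [hX, ← Real.rpow_natCast, ← Real.rpow_mul hn0]; norm_num
  have hX2 : (n : ℝ) ^ ((2 : ℝ) / 3) = X ^ 2 := by
    rw [hX, ← Real.rpow_natCast, ← Real.rpow_mul hn0]; norm_num
  have hXpos : 0 < X := Real.rpow_pos_of_pos (by linarith) _
  have hΔ1 : 1 ≤ Δ := by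
    have h1 : 0 < Real.log n := Real.log_pos (by linarith)
    have h2 : (0 : ℝ) < Δ := lt_of_lt_of_le h1 hlog
    exact_mod_cast h2
  have hΔ1' : (1 : ℝ) ≤ Δ := by exact_mod_cast hΔ1
  have hEX : Real.exp 10 * Δ ≤ X := by
    have h1 := mul_le_mul_of_nonneg_left hΔX (Real.exp_pos 10).le
    rwa [← mul_assoc, ← Real.exp_add, add_neg_cancel, Real.exp_zero, one_mul] at h1
  have hE : (1000 : ℝ) ≤ Real.exp 10 := by
    have h1 : (2 : ℝ) ≤ Real.exp 1 := by
      have := Real.add_one_le_exp (1 : ℝ); linarith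
    have h2 : Real.exp 10 = Real.exp 1 ^ 10 := by
      rw [← Real.exp_nat_mul]; norm_num
    rw [h2]
    have h3 : (2 : ℝ) ^ 10 ≤ Real.exp 1 ^ 10 := pow_le_pow_left₀ (by norm_num) h1 10
    norm_num at h3 ⊢
    linarith
  have hX1000 : 1000 * (Δ : ℝ) ≤ X := le_trans (mul_le_mul_of_nonneg_right hE (by linarith)) hEX
  have hΔ19 : 19 ≤ Δ := by
    have h1 : Real.log n = 3 * Real.log X := by
      rw [← hX3, Real.log_pow]; norm_num
    have h2 : Real.log (Real.exp 10) ≤ Real.log X := by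
      apply Real.log_le_log (Real.exp_pos _)
      have := Real.exp_pos 10
      nlinarith
    rw [Real.log_exp] at h2
    have h3 : (19 : ℝ) ≤ Δ := by linarith
    exact_mod_cast h3
  set m : ℕ := ⌈X / (14 * Δ)⌉₊ with hmdef
  have hμ : 1 ≤ X / (14 * Δ) := by
    rw [le_div_iff₀ (by linarith)]; linarith
  have hm : 1 ≤ m := Nat.one_le_ceil_iff.2 (by linarith)
  have hmX : 7 * (m : ℝ) * Δ ≤ X := by
    have h1 := (Nat.ceil_lt_add_one (a := X / (14 * Δ)) (by linarith)).le
    rw [← hmdef] at h1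
    have h2 : (m : ℝ) ≤ 2 * (X / (14 * Δ)) := by linarith
    have h3 : 2 * (X / (14 * Δ)) * (7 * Δ) = X := by
      field_simp; norm_num
    have h4 : (m : ℝ) * (7 * Δ) ≤ 2 * (X / (14 * Δ)) * (7 * Δ) :=
      mul_le_mul_of_nonneg_right h2 (by linarith)
    linarith
  have hm' : (1 : ℝ) ≤ m := by exact_mod_cast hm
  have hJ : JoinedAt G m := by
    intro A B hd hA hB
    obtain ⟨A', hA', hAc⟩ := Finset.exists_subset_card_eq hA
    obtain ⟨B', hB', hBc⟩ := Finset.exists_subset_card_eq hB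
    obtain ⟨x, hx, y, hy, hxy⟩ := hjoin0 (A' : Set (Fin n)) (B' : Set (Fin n))
      (by rw [Finset.disjoint_coe]; exact Finset.disjoint_of_subset_left hA'
            (Finset.disjoint_of_subset_right hB' hd))
      (by rw [Set.ncard_coe_finset]; exact hAc) (by rw [Set.ncard_coe_finset]; exact hBc)
    exact ⟨x, hA' hx, y, hB' hy, hxy⟩
  have hexp : ∀ M : ℕ, M ≤ 12 * m + Δ + 10 → ∀ U : Finset (Fin n), U.Nonempty → U.card < m →
      M * U.card ≤ (nbr G U).card := by
    intro M hM U hU hUm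
    have h1 := hexp0 (U : Set (Fin n)) (by
      rw [Set.ncard_coe_finset]; exact Finset.card_pos.2 hU) (by
      rw [Set.ncard_coe_finset]; exact Nat.lt_ceil.1 hUm)
    have h2 : {v : Fin n | ∃ x ∈ (U : Set (Fin n)), G.Adj v x} = (nbr G U : Set (Fin n)) := by
      ext v
      simp only [Set.mem_ofPred_eq, Finset.mem_coe, mem_nbr]
      exact ⟨fun ⟨x, hx, hxv⟩ => ⟨x, hx, hxv.symm⟩, fun ⟨x, hx, hxv⟩ => ⟨x, hx, hxv.symm⟩⟩
    rw [h2, Set.ncard_coe_finset, Set.ncard_coe_finset, hX2] at h1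
    rw [← Nat.cast_le (α := ℝ)]
    push_cast
    refine le_trans (mul_le_mul_of_nonneg_right ?_ (Nat.cast_nonneg _)) h1
    have h3 : (M : ℝ) ≤ 12 * m + Δ + 10 := by exact_mod_cast hM
    have h4 : (m : ℝ) ≤ X := by nlinarith
    have h5 : (1000 : ℝ) ≤ X := by linarith
    have h6 : 1000 * X ≤ X ^ 2 := by nlinarith
    have h7 : X ^ 2 ≤ 7 * (Δ : ℝ) * X ^ 2 := by
      have : 0 ≤ X ^ 2 := by positivity
      nlinarith
    linarith
  have hnum := numeric_bound hX3 hmX hX1000 hm hΔ19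
  have hne : Nonempty (Fin n) := ⟨⟨0, by omega⟩⟩
  obtain ⟨root⟩ := hne
  obtain ⟨par0, rk, hrk0, hadj0, hedge0⟩ := exists_par hT root
  set par : Fin n → Fin n := Function.update par0 root root with hpar
  have hpu : ∀ u, u ≠ root → par u = par0 u := fun u hu => by simp [hpar, hu]
  have h0 : par root = root := by simp [hpar]
  have hrk : ∀ u, u ≠ root → rk (par u) < rk u := fun u hu => by rw [hpu u hu]; exact hrk0 u hu
  have hK : ∀ t, (kids par root Finset.univ t).card ≤ Δ := by
    intro t
    have h1 : (T.neighborSet t).ncard ≤ Δ :=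
      le_trans (Finset.le_sup (f := fun v => (T.neighborSet v).ncard) (Finset.mem_univ t)) hdeg
    refine le_trans ?_ h1
    rw [← Set.ncard_coe_finset]
    apply Set.ncard_le_ncard _ (Set.toFinite _)
    intro u hu
    simp only [kids, Finset.coe_filter, Finset.mem_univ, true_and, Set.mem_ofPred_eq] at hu
    have h2 := hadj0 u hu.1
    rw [← hpu u hu.1, hu.2] at h2
    exact h2.symm
  have hmain : ∃ f : Fin n → Fin n, Function.Injective f ∧
      ∀ u, u ≠ root → G.Adj (f u) (f (par u)) := by
    by_cases hbare : ∃ w, (∀ i, i ≤ 2 * m * (4 * m + 6 + (Δ + 1)) + 2 * m + 2 →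
        par^[i] w ≠ root) ∧
      (∀ i, 1 ≤ i → i ≤ 2 * m * (4 * m + 6 + (Δ + 1)) + 2 * m + 2 →
        (kids par root Finset.univ (par^[i] w)).card = 1)
    · obtain ⟨w, hw1, hw2⟩ := hbare
      exact long_case hJ hm rfl hrk hK w hw1 hw2 le_rfl (hexp _ (by omega))
    · exact leaf_case hJ hm hΔ1 rfl h0 hrk hK hbare le_rfl
        (by rw [Fintype.card_fin]; exact hnum) (hexp _ (by omega))
  obtain ⟨f, hf, hfadj⟩ := hmain
  refine ⟨f, hf, fun u v huv => ?_⟩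
  rcases hedge0 u v huv with ⟨hu, h⟩ | ⟨hv, h⟩
  · have := hfadj u hu
    rwa [hpu u hu, h] at this
  · have := hfadj v hv
    rw [hpu v hv, h] at this
    exact this.symm
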